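/- Let 1 < p < 2 and β > 0 with βq ≤ 1, where q = p/(p−1), and let k = [q/2] be the integer part of q/2. For every ε > 0 there exists a closed set E ⊆ 𝕋 with dim(E) ≥ max((2/q)(1 − βq)k − ε, 1 − 2(k+1)β) such that every f ∈ A^1_β(𝕋) satisfying Z(f) = E is cyclic in A^p_β(𝕋). Furthermore, if p = 2k'/(2k'−1) for some positive integer k', then E can be chosen such that dim(E) = 1 − βq. -/

import Mathlib

open MeasureTheory Real Set Filter Topology ENNReal

noncomputable section

instance : Fact (0 < 2 * Real.pi) := ⟨by positivity⟩

/-- The weighted sum `∑ ‖c n‖^p (1+|n|)^{pβ}` of a Fourier-coefficient sequence,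
i.e. `‖c‖_{ℓ^p_β}^p`. -/
def wSum (p β : ℝ) (c : ℤ → ℂ) : ℝ :=
  ∑' n : ℤ, ‖c n‖ ^ p * (1 + |(n : ℝ)|) ^ (p * β)

/-- Membership in `A^p_β(𝕋)` (equivalently `ℓ^p_β(ℤ)`), expressed via the
Fourier coefficient sequence `c`. -/
def MemA (p β : ℝ) (c : ℤ → ℂ) : Prop :=
  Summable fun n : ℤ => ‖c n‖ ^ p * (1 + |(n : ℝ)|) ^ (p * β)

/-- The `A^p_β(𝕋)` (i.e. `ℓ^p_β(ℤ)`) norm of a Fourier-coefficient sequence. -/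
def normA (p β : ℝ) (c : ℤ → ℂ) : ℝ := (wSum p β c) ^ (1 / p)

/-- The function on the circle `𝕋 = ℝ/2πℤ` whose Fourier coefficient sequence is `c`,
namely `t ↦ ∑_{n ∈ ℤ} c_n e^{int}`. -/
def fSum (c : ℤ → ℂ) (t : AddCircle (2 * Real.pi)) : ℂ :=
  ∑' n : ℤ, c n * fourier n t

/-- The zero set `Z(f)` of the function `f` with Fourier coefficients `c`. -/
def zeroSet (c : ℤ → ℂ) : Set (AddCircle (2 * Real.pi)) := {t | fSum c t = 0}

/-- Convolution of coefficient sequences: the Fourier coefficients of the product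
of the corresponding functions/distributions. -/
def convSeq (a c : ℤ → ℂ) (n : ℤ) : ℂ := ∑' k : ℤ, a k * c (n - k)

/-- Cyclicity of (the element with coefficients) `c` in `A^p_β(𝕋)`: there are
trigonometric polynomials `P` (finitely supported coefficient sequences `a`) with
`‖1 - P·f‖_{A^p_β}` arbitrarily small. -/
def IsCyclicA (p β : ℝ) (c : ℤ → ℂ) : Prop :=
  ∀ ε : ℝ, 0 < ε → ∃ a : ℤ → ℂ, (Function.support a).Finite ∧
    normA p β (fun n => (if n = 0 then 1 else 0) - convSeq a c n) < ε

/-- Fourier coefficient `μ̂(n) = ∫ e^{-int} dμ(t)` of a measure on `ℝ/2πℤ`. -/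
def muHat (μ : Measure (AddCircle (2 * Real.pi))) (n : ℤ) : ℂ :=
  ∫ t, fourier (-n) t ∂μ

/-- The `α`-energy `I_α(μ) = ∑_{n ≥ 1} |μ̂(n)|²/(1+n)^{1-α}` of `μ` is finite. -/
def HasFiniteEnergy (α : ℝ) (μ : Measure (AddCircle (2 * Real.pi))) : Prop :=
  Summable fun n : ℕ => ‖muHat μ (n + 1)‖ ^ 2 / (1 + ((n : ℝ) + 1)) ^ (1 - α)

/-- `C_α(E) = 0`: every probability measure supported on a compact subset of `E`
has infinite `α`-energy. -/
def CapacityZero (α : ℝ) (E : Set (AddCircle (2 * Real.pi))) : Prop :=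
  ∀ μ : Measure (AddCircle (2 * Real.pi)), IsProbabilityMeasure μ →
    (∃ K, K ⊆ E ∧ IsCompact K ∧ μ Kᶜ = 0) → ¬ HasFiniteEnergy α μ

/-- `C_α(E) > 0`: some probability measure supported on a compact subset of `E`
has finite `α`-energy. -/
def CapacityPos (α : ℝ) (E : Set (AddCircle (2 * Real.pi))) : Prop :=
  ∃ μ : Measure (AddCircle (2 * Real.pi)), IsProbabilityMeasure μ ∧
    (∃ K, K ⊆ E ∧ IsCompact K ∧ μ Kᶜ = 0) ∧ HasFiniteEnergy α μ

/-- The `k`-fold Minkowski sum `k × E = E + ⋯ + E`. -/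
def kFold (k : ℕ) (E : Set (AddCircle (2 * Real.pi))) : Set (AddCircle (2 * Real.pi)) :=
  {x | ∃ g : Fin k → AddCircle (2 * Real.pi), (∀ i, g i ∈ E) ∧ x = ∑ i, g i}

/-- Smoothness (`C^∞`) of a function on the circle, via its lift to `ℝ`. -/
def SmoothOnCircle (φ : AddCircle (2 * Real.pi) → ℂ) : Prop :=
  ContDiff ℝ (⊤ : ℕ∞) fun x : ℝ => φ (↑x)

/-- `supp S ⊆ E` for the distribution `S` with Fourier coefficients `s`:
`⟨S, φ⟩ = ∑ₙ Ŝ(n) φ̂(−n) = 0` for every `C^∞` function `φ` supported in `𝕋 ∖ E`. -/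
def DistSuppIn (s : ℤ → ℂ) (E : Set (AddCircle (2 * Real.pi))) : Prop :=
  ∀ φ : AddCircle (2 * Real.pi) → ℂ, SmoothOnCircle φ → tsupport φ ⊆ Eᶜ →
    ∑' n : ℤ, s n * fourierCoeff φ (-n) = 0

local notation "haar" => (AddCircle.haarAddCircle : Measure (AddCircle (2 * π)))

lemma hs_congr {ι : Type*} {G : Type*} [AddCommMonoid G] [TopologicalSpace G] {f g : ι → G} {a b : G}
    (h : HasSum f a) (hf : ∀ n, g n = f n) (hb : b = a) : HasSum g b := by
  have : g = f := funext hf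
  rw [this, hb]; exact h

lemma aux_hasSum_cos (t : ℝ) (ht : |t| ≤ 2 * π) :
    HasSum (fun n : ℕ => 1 / (n : ℝ) ^ 2 * cos (n * t)) (π ^ 2 / 6 - π * |t| / 2 + t ^ 2 / 4) := by
  have hpi := Real.pi_pos
  have hx : |t| / (2 * π) ∈ Icc (0 : ℝ) 1 := by
    constructor
    · positivity
    · rw [div_le_one (by positivity)]; exact ht
  have h := hasSum_one_div_nat_pow_mul_cos (k := 1) one_ne_zero hx
  have e : Polynomial.eval (|t| / (2 * π))
      (Polynomial.map (algebraMap ℚ ℝ) (Polynomial.bernoulli (2 * 1))) =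
      (|t| / (2 * π)) ^ 2 - (|t| / (2 * π)) + 6⁻¹ := bernoulliFun_two _
  rw [e] at h
  refine hs_congr h (fun n => ?_) ?_
  · rw [mul_one]
    congr 1
    rw [show 2 * π * (n : ℝ) * (|t| / (2 * π)) = n * |t| by field_simp]
    rcases abs_cases t with h | h <;> rw [h.1]
    rw [mul_neg, Real.cos_neg]
  · have : t ^ 2 = |t| ^ 2 := (sq_abs t).symm
    rw [this]
    generalize |t| = y
    norm_num
    field_simp
    ring

/-- The normalized Fourier coefficients of the triangle kernel of half-width `δ`. -/
def ww (δ : ℝ) (n : ℤ) : ℝ := if n = 0 then 1 else 2 * (1 - cos (δ * n)) / (δ * n) ^ 2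

lemma ww_zero (δ : ℝ) : ww δ 0 = 1 := by simp [ww]

lemma ww_neg (δ : ℝ) (n : ℤ) : ww δ (-n) = ww δ n := by
  unfold ww
  simp

lemma ww_nonneg (δ : ℝ) (n : ℤ) : 0 ≤ ww δ n := by
  unfold ww
  split_ifs
  · norm_num
  · have := Real.cos_le_one (δ * n)
    have : 0 ≤ 1 - cos (δ * n) := by linarith
    positivity

lemma ww_le_one (δ : ℝ) (n : ℤ) : ww δ n ≤ 1 := by
  unfold ww
  split_ifs
  · norm_num
  · apply div_le_one_of_le₀ _ (by positivity)
    have := Real.one_sub_sq_div_two_le_cos (x := δ * n)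
    linarith

lemma ww_le (δ : ℝ) (n : ℤ) : ww δ n * (δ * n) ^ 2 ≤ 4 := by
  unfold ww
  split_ifs with h
  · simp [h]
  · by_cases hd : δ * n = 0
    · rw [hd]; norm_num
    · rw [div_mul_cancel₀ _ (by positivity)]
      have := Real.neg_one_le_cos (δ * n)
      linarith

lemma fourier_coe' (n : ℤ) (t : ℝ) :
    (fourier n (t : AddCircle (2 * π)) : ℂ) = Complex.cos (n * t) + Complex.sin (n * t) * Complex.I := by
  rw [fourier_coe_apply, ← Complex.exp_mul_I]
  congr 1
  have : (π : ℂ) ≠ 0 := by exact_mod_cast Real.pi_ne_zero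
  push_cast
  field_simp

lemma ww_hasSum (δ t : ℝ) (hδ : 0 < δ) (hδ' : δ ≤ π) (ht : |t| ≤ π) :
    HasSum (fun n : ℤ => (ww δ n : ℂ) * fourier n (t : AddCircle (2 * π)))
      (((π / δ ^ 2) * (|t + δ| + |t - δ| - 2 * |t|) : ℝ) : ℂ) := by
  have hpi := Real.pi_pos
  have h1 := aux_hasSum_cos t (by linarith)
  have h2 := aux_hasSum_cos (t + δ) (by
    have := abs_add_le t δ; rw [abs_of_pos hδ] at this; linarith)
  have h3 := aux_hasSum_cos (t - δ) (by
    have := abs_sub t δ; rw [abs_of_pos hδ] at this; linarith)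
  -- real cosine sum
  have h4 : HasSum (fun n : ℕ => (if n = 0 then (0 : ℝ) else 2 * (1 - cos (δ * n)) / (δ * n) ^ 2) * cos (n * t))
      ((π / δ ^ 2) * (|t + δ| + |t - δ| - 2 * |t|) / 2 - 1 / 2) := by
    have := ((h1.mul_left 2).sub (h2.add h3)).mul_left (1 / δ ^ 2)
    refine hs_congr this (fun n => ?_) ?_
    · by_cases hn : n = 0
      · simp [hn]
      · rw [if_neg hn]
        have hn' : (n : ℝ) ≠ 0 := by exact_mod_cast hn
        rw [show (n : ℝ) * (t + δ) = n * t + δ * n by ring,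
          show (n : ℝ) * (t - δ) = n * t - δ * n by ring, Real.cos_add, Real.cos_sub]
        field_simp
        ring
    · field_simp
      ring
  have h5 : HasSum (fun n : ℕ => ww δ n * cos (n * t))
      ((π / δ ^ 2) * (|t + δ| + |t - δ| - 2 * |t|) / 2 + 1 / 2) := by
    have h6 : HasSum (fun n : ℕ => if n = 0 then (1 : ℝ) else 0) 1 := hasSum_ite_eq 0 1
    refine hs_congr (h4.add h6) (fun n => ?_) ?_
    · by_cases hn : n = 0
      · simp [hn, ww]
      · simp [hn, ww]
    · ring
  have hb : ∀ n : ℕ, ‖ww δ n * sin (n * t)‖ ≤ 4 / δ ^ 2 * (1 / (n : ℝ) ^ 2) + (if n = 0 then 1 else 0) := by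
    intro n
    rw [norm_mul, Real.norm_eq_abs, Real.norm_eq_abs, abs_of_nonneg (ww_nonneg _ _)]
    by_cases hn : n = 0
    · simp [hn]
    · have hn' : 0 < (n : ℝ) := by exact_mod_cast Nat.pos_of_ne_zero hn
      have h1 := ww_le δ n
      have h2 := Real.abs_sin_le_one (n * t)
      have h3 := ww_nonneg δ n
      rw [if_neg hn, add_zero, div_mul_div_comm, mul_one, ← mul_pow, le_div_iff₀ (by positivity)]
      push_cast at h1
      have h4 : ww δ n * |sin (n * t)| ≤ ww δ n := mul_le_of_le_one_right h3 h2
      exact le_trans (mul_le_mul_of_nonneg_right h4 (by positivity)) h1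
  have h7 : Summable (fun n : ℕ => ww δ n * sin (n * t)) := by
    apply Summable.of_norm_bounded _ hb
    apply Summable.add
    · apply Summable.mul_left
      exact Real.summable_one_div_nat_pow.2 (by norm_num)
    · exact (hasSum_ite_eq 0 1).summable
  have h8 := h7.hasSum
  set σ := ∑' n : ℕ, ww δ n * sin (n * t)
  have h9 := (Complex.hasSum_ofReal.2 h5).add ((Complex.hasSum_ofReal.2 h8).mul_right Complex.I)
  have h10 := (Complex.hasSum_ofReal.2 h5).sub ((Complex.hasSum_ofReal.2 h8).mul_right Complex.I)
  have := HasSum.of_nat_of_neg (f := fun n : ℤ => (ww δ n : ℂ) * fourier n (t : AddCircle (2 * π)))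
    (hs_congr h9 (fun n => by rw [fourier_coe']; push_cast; ring) rfl)
    (hs_congr h10 (fun n => by
        rw [fourier_coe', ww_neg]; push_cast
        rw [neg_mul, Complex.cos_neg, Complex.sin_neg]; ring) rfl)
  refine hs_congr this (fun n => rfl) ?_
  simp only [ww_zero, fourier_zero]
  push_cast
  ring

lemma exists_rep (t : AddCircle (2 * π)) : ∃ s : ℝ, (s : AddCircle (2 * π)) = t ∧ |s| ≤ π ∧ ‖t‖ = |s| := by
  have hpi := Real.pi_pos
  obtain ⟨s, hs⟩ := QuotientAddGroup.mk_surjective t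
  have hs' : (s : AddCircle (2 * π)) = t := hs
  refine ⟨s - round ((2 * π)⁻¹ * s) * (2 * π), ?_, ?_, ?_⟩
  · rw [← hs', AddCircle.coe_sub]
    have : ((round ((2 * π)⁻¹ * s) * (2 * π) : ℝ) : AddCircle (2 * π)) = 0 := by
      rw [AddCircle.coe_eq_zero_iff]
      exact ⟨round ((2 * π)⁻¹ * s), by simp⟩
    rw [this, sub_zero]
  · rw [← AddCircle.norm_eq, hs']
    have := AddCircle.norm_le_half_period (2 * π) (x := t) (by positivity)
    rw [abs_of_pos (by positivity)] at this
    linarith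
  · rw [← hs', AddCircle.norm_eq]

lemma fSum_ww_zero (δ : ℝ) (hδ : 0 < δ) (hδ' : δ ≤ π) (t : AddCircle (2 * π)) (ht : δ ≤ ‖t‖) :
    fSum (fun n => (ww δ n : ℂ)) t = 0 := by
  obtain ⟨s, rfl, hs, hn⟩ := exists_rep t
  unfold fSum
  rw [(ww_hasSum δ s hδ hδ' hs).tsum_eq]
  rw [hn] at ht
  norm_cast
  apply mul_eq_zero_of_right
  rcases abs_cases s with h | h <;> rcases abs_cases (s + δ) with h' | h' <;>
    rcases abs_cases (s - δ) with h'' | h'' <;> linarith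

/-- Fourier coefficients of the trapezoid equal to `1` on `[-δ, δ]`. -/
def chi (δ : ℝ) (n : ℤ) : ℝ := (9 * δ * ww (3 * δ) n - δ * ww δ n) / (4 * π)

lemma fSum_chi (δ : ℝ) (hδ : 0 < δ) (hδ' : δ ≤ 1) (t : AddCircle (2 * π)) (ht : ‖t‖ ≤ δ) :
    fSum (fun n => (chi δ n : ℂ)) t = 1 := by
  have hpi := Real.pi_gt_three
  obtain ⟨s, rfl, hs, hn⟩ := exists_rep t
  unfold fSum
  have h1 := (ww_hasSum (3 * δ) s (by linarith) (by linarith) hs).mul_left (9 * δ / (4 * π) : ℂ)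
  have h2 := (ww_hasSum δ s hδ (by linarith) hs).mul_left (δ / (4 * π) : ℂ)
  have h3 := h1.sub h2
  have e : (fun n : ℤ => (chi δ n : ℂ) * fourier n (s : AddCircle (2 * π))) = fun n : ℤ =>
    (9 * δ / (4 * π) : ℂ) * ((ww (3 * δ) n : ℂ) * fourier n (s : AddCircle (2 * π))) -
    (δ / (4 * π) : ℂ) * ((ww δ n : ℂ) * fourier n (s : AddCircle (2 * π))) := by
    funext n
    unfold chi
    push_cast
    ring
  rw [e, h3.tsum_eq]
  rw [hn] at ht
  norm_cast
  have a1 : |s + 3 * δ| + |s - 3 * δ| = 6 * δ := by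
    rcases abs_cases s with h | h <;> rcases abs_cases (s + 3 * δ) with h' | h' <;>
    rcases abs_cases (s - 3 * δ) with h'' | h'' <;> linarith
  have a2 : |s + δ| + |s - δ| = 2 * δ := by
    rcases abs_cases s with h | h <;> rcases abs_cases (s + δ) with h' | h' <;>
    rcases abs_cases (s - δ) with h'' | h'' <;> linarith
  rw [a1, a2]
  field_simp
  ring

lemma abs_chi_le (δ : ℝ) (hδ : 0 < δ) (n : ℤ) : |chi δ n| ≤ δ := by
  have hpi := Real.pi_gt_three
  unfold chi
  have h1 := ww_nonneg (3 * δ) n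
  have h2 := ww_le_one (3 * δ) n
  have h3 := ww_nonneg δ n
  have h4 := ww_le_one δ n
  rw [abs_div, abs_of_pos (show 0 < 4 * π by linarith), div_le_iff₀ (by linarith), abs_le]
  constructor <;> nlinarith

lemma chi_eq (δ : ℝ) (hδ : 0 < δ) (n : ℤ) (hn : n ≠ 0) :
    chi δ n = (cos (δ * n) - cos (3 * δ * n)) / (2 * π * δ * n ^ 2) := by
  have hpi := Real.pi_pos
  have hn' : (n : ℝ) ≠ 0 := by exact_mod_cast hn
  unfold chi ww
  rw [if_neg hn, if_neg hn]
  field_simp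
  ring


lemma chi_diff_aux (δ x y a b : ℝ) (hδ : 0 < δ) (hx : 1 ≤ |x|) (hy : 1 ≤ |y|) (hxy : |x - y| ≤ 1)
    (ha : |a| ≤ 2 * δ * |x|) (hab : |a - b| ≤ 4 * δ) :
    |b / (2 * π * δ * y ^ 2) - a / (2 * π * δ * x ^ 2)| ≤ 20 / x ^ 2 := by
  have hpi := Real.pi_gt_three
  have hx0 : x ≠ 0 := by rintro rfl; norm_num at hx
  have hy0 : y ≠ 0 := by rintro rfl; norm_num at hy
  have e : b / (2 * π * δ * y ^ 2) - a / (2 * π * δ * x ^ 2) =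
     ((b - a) * x ^ 2 + a * ((x - y) * (x + y))) / (2 * π * δ * y ^ 2 * x ^ 2) := by
    field_simp
    ring
  have hX : |x| ≤ 2 * |y| := by
    have := abs_sub_abs_le_abs_sub x y; linarith
  have hY : |y| ≤ 2 * |x| := by
    have := abs_sub_abs_le_abs_sub y x; rw [abs_sub_comm] at this; linarith
  rw [e, abs_div, abs_of_pos (show 0 < 2 * π * δ * y ^ 2 * x ^ 2 by positivity), div_le_div_iff₀ (by positivity) (by positivity)]
  have h1 : |(b - a) * x ^ 2 + a * ((x - y) * (x + y))| ≤ 4 * δ * (4 * |y| ^ 2) + 2 * δ * |x| * (1 * (3 * |y|)) := by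
    refine (abs_add_le _ _).trans ?_
    rw [abs_mul, abs_mul a, abs_mul (x - y), abs_pow, abs_sub_comm b a]
    have : |x + y| ≤ 3 * |y| := (abs_add_le _ _).trans (by linarith)
    have : |x| ^ 2 ≤ 4 * |y| ^ 2 := by nlinarith
    gcongr
  have h2 : |(b - a) * x ^ 2 + a * ((x - y) * (x + y))| ≤ 28 * δ * |y| ^ 2 := by
    refine h1.trans ?_
    have : δ * |x| * |y| ≤ δ * (2 * |y|) * |y| := by gcongr
    nlinarith
  rw [← sq_abs y]
  calc _ ≤ 28 * δ * |y| ^ 2 * x ^ 2 := by gcongr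
    _ ≤ 20 * (2 * π * δ * |y| ^ 2 * x ^ 2) := by
      have : 0 ≤ δ * |y| ^ 2 * x ^ 2 := by positivity
      nlinarith

lemma chi_diff (δ : ℝ) (hδ : 0 < δ) (hδ' : δ ≤ 1) (n : ℤ) :
    |chi δ (n - 1) - chi δ n| ≤ 100 / (1 + |(n : ℝ)|) ^ 2 := by
  have hpi := Real.pi_gt_three
  have hb : |chi δ (n - 1) - chi δ n| ≤ 2 := by
    have h1 := abs_chi_le δ hδ (n - 1)
    have h2 := abs_chi_le δ hδ n
    have := abs_sub (chi δ (n - 1)) (chi δ n)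
    linarith
  by_cases h0 : n = 0
  · subst h0; refine hb.trans ?_; norm_num
  by_cases h1 : n = 1
  · subst h1; refine hb.trans ?_; norm_num
  rw [chi_eq δ hδ n h0, chi_eq δ hδ (n - 1) (by omega)]
  have hx : 1 ≤ |(n : ℝ)| := by exact_mod_cast Int.one_le_abs h0
  have hy : 1 ≤ |((n - 1 : ℤ) : ℝ)| := by exact_mod_cast Int.one_le_abs (by omega)
  refine (chi_diff_aux δ n ((n - 1 : ℤ) : ℝ) _ _ hδ hx hy (by push_cast; simp) ?_ ?_).trans ?_
  · refine (Real.abs_cos_sub_cos_le _ _).trans ?_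
    rw [show δ * (n : ℝ) - 3 * δ * n = - (2 * δ * n) by ring, abs_neg, abs_mul, abs_of_pos (by linarith : 0 < 2 * δ)]
  · rw [show cos (δ * (n : ℝ)) - cos (3 * δ * n) - (cos (δ * ((n - 1 : ℤ) : ℝ)) - cos (3 * δ * ((n - 1 : ℤ) : ℝ)))
      = (cos (δ * (n : ℝ)) - cos (δ * ((n - 1 : ℤ) : ℝ))) - (cos (3 * δ * n) - cos (3 * δ * ((n - 1 : ℤ) : ℝ))) by ring]
    refine (abs_sub _ _).trans ?_
    have h1 := Real.abs_cos_sub_cos_le (δ * (n : ℝ)) (δ * ((n - 1 : ℤ) : ℝ))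
    have h2 := Real.abs_cos_sub_cos_le (3 * δ * (n : ℝ)) (3 * δ * ((n - 1 : ℤ) : ℝ))
    rw [show δ * (n : ℝ) - δ * ((n - 1 : ℤ) : ℝ) = δ by push_cast; ring, abs_of_pos hδ] at h1
    rw [show 3 * δ * (n : ℝ) - 3 * δ * ((n - 1 : ℤ) : ℝ) = 3 * δ by push_cast; ring, abs_of_pos (show (0 : ℝ) < 3 * δ by linarith)] at h2
    linarith
  · rw [← sq_abs (n : ℝ), div_le_div_iff₀ (by positivity) (by positivity)]
    nlinarith


/-- The weight `(1+|n|)^β`. -/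
def om (β : ℝ) (n : ℤ) : ℝ := (1 + |(n : ℝ)|) ^ β

lemma om_pos (β : ℝ) (n : ℤ) : 0 < om β n := by unfold om; positivity

lemma one_le_om {β : ℝ} (hβ : 0 ≤ β) (n : ℤ) : 1 ≤ om β n := by
  unfold om
  apply Real.one_le_rpow _ hβ
  have := abs_nonneg (n : ℝ)
  linarith

lemma om_neg (β : ℝ) (n : ℤ) : om β (-n) = om β n := by
  unfold om; push_cast; rw [abs_neg]

lemma om_zero (β : ℝ) : om β 0 = 1 := by
  unfold om; simp

lemma om_add_le {β : ℝ} (hβ : 0 ≤ β) (a b : ℤ) : om β (a + b) ≤ om β a * om β b := by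
  unfold om
  rw [← Real.mul_rpow (by positivity) (by positivity)]
  apply Real.rpow_le_rpow (by positivity) _ hβ
  have := abs_add_le (a : ℝ) b
  have := mul_nonneg (abs_nonneg (a : ℝ)) (abs_nonneg (b : ℝ))
  push_cast
  nlinarith

lemma om_sub_le {β : ℝ} (hβ : 0 ≤ β) (a b : ℤ) : om β (a - b) ≤ om β a * om β b := by
  have := om_add_le hβ a (-b)
  rwa [om_neg, ← sub_eq_add_neg] at this

lemma summable_om {s : ℝ} (hs : s < -1) : Summable (om s) := by
  have h : Summable (fun n : ℕ => ((1 : ℝ) + n) ^ s) := by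
    have := (summable_nat_add_iff 1).2 (Real.summable_nat_rpow.2 hs)
    refine this.congr (fun n => ?_)
    push_cast
    rw [add_comm]
  apply Summable.of_nat_of_neg
  · refine h.congr (fun n => ?_)
    unfold om; simp
  · refine h.congr (fun n => ?_)
    unfold om; simp

lemma om_mul_om (a b : ℝ) (n : ℤ) : om a n * om b n = om (a + b) n := by
  unfold om
  rw [Real.rpow_add (by positivity)]

lemma om_two (n : ℤ) : om (-2) n = 1 / (1 + |(n : ℝ)|) ^ 2 := by
  unfold om
  rw [Real.rpow_neg (by positivity)]
  norm_num

lemma summable_om_ww {β δ : ℝ} (hβ1 : β < 1) (hδ : 0 < δ) :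
    Summable (fun n => om β n * ww δ n) := by
  apply Summable.of_nonneg_of_le (fun n => mul_nonneg (om_pos _ _).le (ww_nonneg _ _)) _
    ((summable_om (s := β + (-2)) (by linarith)).mul_left (2 + 8 / δ ^ 2))
  intro n
  rw [← om_mul_om, om_two]
  have h1 := ww_le_one δ n
  have h2 := ww_le δ n
  have h0 := om_pos β n
  have h3 := ww_nonneg δ n
  have h4 : ww δ n ≤ (2 + 8 / δ ^ 2) * (1 / (1 + |(n : ℝ)|) ^ 2) := by
    rw [mul_one_div, le_div_iff₀ (by positivity)]
    have h5 : ww δ n * (n : ℝ) ^ 2 ≤ 4 / δ ^ 2 := by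
      rw [le_div_iff₀ (by positivity)]
      calc _ = ww δ n * (δ * n) ^ 2 := by ring
        _ ≤ 4 := h2
    have h6 : (1 + |(n : ℝ)|) ^ 2 ≤ 2 + 2 * (n : ℝ) ^ 2 := by
      rw [← sq_abs (n : ℝ)]
      nlinarith [sq_nonneg (1 - |(n : ℝ)|)]
    calc _ ≤ ww δ n * (2 + 2 * (n : ℝ) ^ 2) := by gcongr
      _ = 2 * ww δ n + 2 * (ww δ n * (n : ℝ) ^ 2) := by ring
      _ ≤ 2 * 1 + 2 * (4 / δ ^ 2) := by gcongr
      _ = _ := by ring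
  calc om β n * ww δ n ≤ om β n * ((2 + 8 / δ ^ 2) * (1 / (1 + |(n : ℝ)|) ^ 2)) := by gcongr
    _ = _ := by ring

lemma summable_ww {δ : ℝ} (hδ : 0 < δ) : Summable (fun n => ww δ n) := by
  have := summable_om_ww (β := 0) (by norm_num) hδ
  refine this.congr (fun n => ?_)
  simp [om]

lemma summable_chi {δ : ℝ} (hδ : 0 < δ) : Summable (fun n => ‖(chi δ n : ℂ)‖) := by
  have h1 := (summable_ww (δ := 3 * δ) (by linarith)).mul_left (9 * δ)
  have h2 := (summable_ww hδ).mul_left δ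
  have h3 := ((h1.sub h2).div_const (4 * π)).norm
  refine h3.congr (fun n => ?_)
  unfold chi
  rw [Complex.norm_real]

lemma summable_om_chi {β δ : ℝ} (hβ1 : β < 1) (hδ : 0 < δ) :
    Summable (fun n => om β n * ‖(chi δ n : ℂ)‖) := by
  have h1 := (summable_om_ww hβ1 (δ := 3 * δ) (by linarith)).mul_left (9 * δ)
  have h2 := (summable_om_ww hβ1 hδ).mul_left δ
  have h3 := ((h1.sub h2).div_const (4 * π)).norm
  refine h3.congr (fun n => ?_)
  unfold chi
  rw [Complex.norm_real, ← abs_of_pos (om_pos β n), ← Real.norm_eq_abs, ← norm_mul]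
  rw [Real.norm_eq_abs (om β n), abs_of_pos (om_pos β n)]
  congr 1
  ring


lemma norm_fourier_apply (n : ℤ) (t : AddCircle (2 * π)) : ‖(fourier n t : ℂ)‖ = 1 := by
  rw [fourier_apply]; exact Circle.norm_coe _

lemma summable_fSum {a : ℤ → ℂ} (ha : Summable (fun n => ‖a n‖)) (t : AddCircle (2 * π)) :
    Summable (fun n => a n * fourier n t) := by
  apply Summable.of_norm
  refine ha.congr (fun n => ?_)
  rw [norm_mul, norm_fourier_apply, mul_one]

lemma continuous_fSum {a : ℤ → ℂ} (ha : Summable (fun n => ‖a n‖)) : Continuous (fSum a) := by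
  unfold fSum
  apply continuous_tsum (fun n => by fun_prop) ha
  intro n t
  rw [norm_mul, norm_fourier_apply, mul_one]

lemma integral_fourier (n : ℤ) : ∫ t, (fourier n t : ℂ) ∂haar = if n = 0 then 1 else 0 := by
  have := congrFun (fourierCoeff_fourier (T := 2 * π) n) 0
  unfold fourierCoeff at this
  simp only [neg_zero, fourier_zero, one_smul] at this
  rw [this, Pi.single_apply]
  simp [eq_comm]

lemma intSum {G : AddCircle (2 * π) → ℂ} (hG : Integrable G haar) {a : ℤ → ℂ}
    (ha : Summable (fun n => ‖a n‖)) :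
    HasSum (fun n => a n * ∫ t, G t * fourier n t ∂haar) (∫ t, G t * fSum a t ∂haar) := by
  have hi : ∀ n : ℤ, Integrable (fun t => G t * fourier n t) haar := by
    intro n
    refine hG.mul_bdd (c := 1) (by fun_prop) (ae_of_all _ (fun t => ?_))
    rw [norm_fourier_apply]
  have := hasSum_integral_of_summable_integral_norm (μ := haar)
    (F := fun (n : ℤ) t => a n * (G t * fourier n t)) (fun n => (hi n).const_mul _) ?_
  · refine hs_congr this (fun n => ?_) ?_
    · rw [integral_const_mul]
    · congr 1
      funext t
      unfold fSum
      rw [← tsum_mul_left]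
      congr 1
      funext n
      ring
  · refine (ha.mul_right (∫ t, ‖G t‖ ∂haar)).congr (fun n => ?_)
    rw [← integral_const_mul]
    congr 1
    funext t
    rw [norm_mul, norm_mul, norm_fourier_apply, mul_one]

lemma coef_fSum {a : ℤ → ℂ} (ha : Summable (fun n => ‖a n‖)) (n : ℤ) :
    ∫ t, fourier (-n) t * fSum a t ∂haar = a n := by
  have h := intSum (G := fun t => fourier (-n) t)
    ((map_continuous (fourier (-n))).integrable_of_hasCompactSupport (HasCompactSupport.of_compactSpace _)) ha
  rw [← h.tsum_eq]
  rw [tsum_eq_single n]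
  · simp only [← fourier_add]
    rw [integral_fourier]
    simp
  · intro b hb
    simp only [← fourier_add]
    rw [integral_fourier, if_neg (by omega), mul_zero]

lemma chi_conv {δ : ℝ} (hδ : 0 < δ) (hδ' : δ ≤ 1) (n : ℤ) :
    HasSum (fun j => (ww δ (n - j) : ℂ) * chi δ j) (ww δ n) := by
  have hpi := Real.pi_gt_three
  have hw : Summable (fun n => ‖(ww δ n : ℂ)‖) := by
    refine (summable_ww hδ).congr (fun n => ?_)
    rw [Complex.norm_real, Real.norm_eq_abs, abs_of_nonneg (ww_nonneg _ _)]
  have hcont : Continuous (fun t => fourier (-n) t * fSum (fun n => (ww δ n : ℂ)) t) := by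
    have := continuous_fSum hw
    fun_prop
  have h := intSum (G := fun t => fourier (-n) t * fSum (fun n => (ww δ n : ℂ)) t)
    (hcont.integrable_of_hasCompactSupport (HasCompactSupport.of_compactSpace _)) (summable_chi hδ)
  refine hs_congr h (fun j => ?_) ?_
  · have := coef_fSum hw (n - j)
    simp only [← this]
    rw [mul_comm]
    congr 2
    funext t
    rw [neg_sub, sub_eq_add_neg, fourier_add]
    ring
  · rw [← coef_fSum hw n]
    congr 1
    funext t
    rcases le_total δ ‖t‖ with h | h
    · rw [fSum_ww_zero δ hδ (by linarith) t h]; ring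
    · rw [fSum_chi δ hδ hδ' t h]; ring

lemma conv_bound {β N : ℝ} (hβ : 0 ≤ β) {W v : ℤ → ℂ} (hW : ∀ n, ‖W n‖ ≤ N * om β n)
    (hv : Summable (fun j => om β j * ‖v j‖)) (n : ℤ) :
    Summable (fun j => W (n - j) * v j) ∧
    ‖∑' j, W (n - j) * v j‖ ≤ N * om β n * ∑' j, om β j * ‖v j‖ := by
  have hN : 0 ≤ N := by
    have := (norm_nonneg _).trans (hW 0)
    rwa [om_zero, mul_one] at this
  have hb : ∀ j, ‖W (n - j) * v j‖ ≤ N * om β n * (om β j * ‖v j‖) := by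
    intro j
    rw [norm_mul]
    calc _ ≤ N * (om β n * om β j) * ‖v j‖ := by
          gcongr
          refine (hW _).trans ?_
          gcongr
          exact om_sub_le hβ _ _
      _ = _ := by ring
  have hs := hv.mul_left (N * om β n)
  refine ⟨Summable.of_norm_bounded hs hb, ?_⟩
  rw [← tsum_mul_left]
  exact tsum_of_norm_bounded hs.hasSum hb

lemma conv_assoc {β N : ℝ} (hβ : 0 ≤ β) {S a b : ℤ → ℂ} (hS : ∀ n, ‖S n‖ ≤ N * om β n)
    (ha : Summable (fun j => om β j * ‖a j‖)) (hb : Summable (fun j => om β j * ‖b j‖)) (n : ℤ) :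
    ∑' j, (∑' k, S (n - j - k) * a k) * b j = ∑' k, S (n - k) * ∑' j, a (k - j) * b j := by
  have hN : 0 ≤ N := by
    have := (norm_nonneg _).trans (hS 0)
    rwa [om_zero, mul_one] at this
  have hF : Summable (fun p : ℤ × ℤ => S (n - p.1 - p.2) * a p.2 * b p.1) := by
    have := (hb.mul_of_nonneg ha (fun j => mul_nonneg (om_pos _ _).le (norm_nonneg _))
      (fun j => mul_nonneg (om_pos _ _).le (norm_nonneg _))).mul_left (N * om β n)
    refine Summable.of_norm_bounded this (fun p => ?_)
    rw [norm_mul, norm_mul]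
    calc _ ≤ N * (om β n * om β p.1 * om β p.2) * ‖a p.2‖ * ‖b p.1‖ := by
          gcongr
          refine (hS _).trans ?_
          gcongr
          refine (om_sub_le hβ _ _).trans ?_
          have := om_pos β p.2
          gcongr
          exact om_sub_le hβ _ _
      _ = _ := by ring
  let e : ℤ × ℤ ≃ ℤ × ℤ :=
    { toFun := fun p => (p.1, p.2 - p.1)
      invFun := fun p => (p.1, p.2 + p.1)
      left_inv := fun p => by simp
      right_inv := fun p => by simp }
  have hF' := (e.summable_iff).2 hF
  calc _ = ∑' j, ∑' k, S (n - j - k) * a k * b j := by simp_rw [tsum_mul_right]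
    _ = ∑' j, ∑' k, S (n - j - (k - j)) * a (k - j) * b j := by
        congr 1
        funext j
        exact ((Equiv.subRight j).tsum_eq (fun k => S (n - j - k) * a k * b j)).symm
    _ = ∑' k, ∑' j, S (n - j - (k - j)) * a (k - j) * b j :=
        (Summable.tsum_comm (f := fun j k => S (n - j - (k - j)) * a (k - j) * b j) hF').symm
    _ = _ := by
        congr 1
        funext k
        rw [← tsum_mul_left]
        congr 1
        funext j
        rw [show n - j - (k - j) = n - k by ring]
        ring

lemma conv_comm (a b : ℤ → ℂ) (k : ℤ) : ∑' j, a (k - j) * b j = ∑' j, b (k - j) * a j := by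
  rw [← (Equiv.subLeft k).tsum_eq (fun j => a (k - j) * b j)]
  congr 1
  funext j
  simp [mul_comm]

/-- The size of `(e^{it} - 1) χ_δ` in the weighted Wiener algebra. -/
def theta (β δ : ℝ) : ℝ := ∑' j, om β j * |chi δ (j - 1) - chi δ j|

lemma theta_term_le {β δ : ℝ} (hδ : 0 < δ) (hδ' : δ ≤ 1) (j : ℤ) :
    om β j * |chi δ (j - 1) - chi δ j| ≤ 100 * om (β + (-2)) j := by
  rw [← om_mul_om, om_two]
  have := chi_diff δ hδ hδ' j
  have h := om_pos β j
  calc _ ≤ om β j * (100 / (1 + |(j : ℝ)|) ^ 2) := by gcongr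
    _ = _ := by ring

lemma theta_summable {β δ : ℝ} (hβ1 : β < 1) (hδ : 0 < δ) (hδ' : δ ≤ 1) :
    Summable (fun j => om β j * |chi δ (j - 1) - chi δ j|) :=
  Summable.of_nonneg_of_le (fun j => mul_nonneg (om_pos _ _).le (abs_nonneg _))
    (theta_term_le hδ hδ') ((summable_om (s := β + (-2)) (by linarith)).mul_left 100)

lemma theta_nonneg (β δ : ℝ) : 0 ≤ theta β δ :=
  tsum_nonneg (fun j => mul_nonneg (om_pos _ _).le (abs_nonneg _))

lemma theta_tendsto {β : ℝ} (hβ1 : β < 1) : Tendsto (theta β) (𝓝[>] 0) (𝓝 0) := by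
  have hI : ∀ᶠ δ : ℝ in 𝓝[>] 0, 0 < δ ∧ δ ≤ 1 := by
    filter_upwards [Ioc_mem_nhdsGT (show (0 : ℝ) < 1 by norm_num)] with δ h using h
  have := tendsto_tsum_of_dominated_convergence (𝓕 := 𝓝[>] (0 : ℝ))
    (f := fun δ j => om β j * |chi δ (j - 1) - chi δ j|) (g := fun _ => 0)
    (bound := fun j => 100 * om (β + (-2)) j)
    ((summable_om (s := β + (-2)) (by linarith)).mul_left 100) ?_ ?_
  · rw [tsum_zero] at this
    exact this
  · intro j
    have h0 : Tendsto (fun δ : ℝ => om β j * (2 * δ)) (𝓝[>] 0) (𝓝 0) := by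
      have : Tendsto (fun δ : ℝ => om β j * (2 * δ)) (𝓝 0) (𝓝 (om β j * (2 * 0))) := by
        apply Continuous.tendsto; fun_prop
      rw [mul_zero, mul_zero] at this
      exact this.mono_left nhdsWithin_le_nhds
    refine squeeze_zero' (Eventually.of_forall fun δ => mul_nonneg (om_pos _ _).le (abs_nonneg _)) ?_ h0
    filter_upwards [hI] with δ hδ
    have h := om_pos β j
    gcongr
    have h1 := abs_chi_le δ hδ.1 (j - 1)
    have h2 := abs_chi_le δ hδ.1 j
    have := abs_sub (chi δ (j - 1)) (chi δ j)
    linarith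
  · filter_upwards [hI] with δ hδ
    intro j
    rw [Real.norm_eq_abs, abs_of_nonneg (mul_nonneg (om_pos _ _).le (abs_nonneg _))]
    exact theta_term_le hδ.1 hδ.2 j


/-- The local contraction constant attached to a frequency. -/
def tht (β δ : ℝ) (k : ℤ) : ℝ := min (2 * om β k) (|(k : ℝ)| * om β k ^ 2 * theta β δ)

lemma tht_nonneg (β δ : ℝ) (k : ℤ) : 0 ≤ tht β δ k := by
  have := om_pos β k
  have := theta_nonneg β δ
  unfold tht
  positivity

lemma tht_summable {β : ℝ} (δ : ℝ) {c : ℤ → ℂ} (hc : Summable (fun k => om β k * ‖c k‖)) :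
    Summable (fun k => ‖c k‖ * tht β δ k) := by
  refine Summable.of_nonneg_of_le (fun k => mul_nonneg (norm_nonneg _) (tht_nonneg _ _ _)) (fun k => ?_)
    (hc.mul_left 2)
  calc _ ≤ ‖c k‖ * (2 * om β k) := by
        gcongr
        exact min_le_left _ _
    _ = _ := by ring

lemma exists_delta {β : ℝ} (hβ1 : β < 1) {c : ℤ → ℂ} (hc : Summable (fun k => om β k * ‖c k‖))
    {κ : ℝ} (hκ : 0 < κ) : ∃ δ : ℝ, 0 < δ ∧ δ ≤ 1 ∧ ∑' k, ‖c k‖ * tht β δ k ≤ κ := by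
  have hI : ∀ᶠ δ : ℝ in 𝓝[>] 0, 0 < δ ∧ δ ≤ 1 := by
    filter_upwards [Ioc_mem_nhdsGT (show (0 : ℝ) < 1 by norm_num)] with δ h using h
  have h := tendsto_tsum_of_dominated_convergence (𝓕 := 𝓝[>] (0 : ℝ))
    (f := fun δ k => ‖c k‖ * tht β δ k) (g := fun _ => 0)
    (bound := fun k => 2 * (om β k * ‖c k‖)) (hc.mul_left 2) ?_ ?_
  · rw [tsum_zero] at h
    have h2 := h.eventually (Iic_mem_nhds hκ)
    obtain ⟨δ, h3, h4⟩ := (hI.and h2).exists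
    exact ⟨δ, h3.1, h3.2, h4⟩
  · intro k
    have h0 : Tendsto (fun δ : ℝ => ‖c k‖ * (|(k : ℝ)| * om β k ^ 2 * theta β δ)) (𝓝[>] 0) (𝓝 0) := by
      have := ((theta_tendsto hβ1).const_mul (|(k : ℝ)| * om β k ^ 2)).const_mul ‖c k‖
      rwa [mul_zero, mul_zero] at this
    refine squeeze_zero (fun δ => mul_nonneg (norm_nonneg _) (tht_nonneg _ _ _)) (fun δ => ?_) h0
    gcongr
    exact min_le_right _ _
  · refine Eventually.of_forall (fun δ k => ?_)
    rw [Real.norm_eq_abs, abs_of_nonneg (mul_nonneg (norm_nonneg _) (tht_nonneg _ _ _))]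
    calc _ ≤ ‖c k‖ * (2 * om β k) := by
          gcongr
          exact min_le_left _ _
      _ = _ := by ring

lemma diff_bound {β δ N : ℝ} (hβ : 0 ≤ β) (hβ1 : β < 1) (hδ : 0 < δ) (hδ' : δ ≤ 1) {W : ℤ → ℂ}
    (hW : ∀ n, ‖W n‖ ≤ N * om β n) (hN : 0 ≤ N)
    (hchi : ∀ n, ∑' j, W (n - j) * chi δ j = W n) (k n : ℤ) :
    ‖W (n - k) - W n‖ ≤ tht β δ k * (N * om β n) := by
  have hθ := theta_nonneg β δ
  have h1 : ∀ n, ‖W (n - 1) - W n‖ ≤ theta β δ * (N * om β n) := by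
    intro n
    have hs := fun n => (conv_bound hβ hW (summable_om_chi hβ1 hδ) n).1
    have e : W (n - 1) = ∑' j, W (n - j) * chi δ (j - 1) := by
      rw [← hchi (n - 1), ← (Equiv.subRight (1 : ℤ)).tsum_eq]
      congr 1
      funext j
      simp only [Equiv.subRight_apply]
      rw [show n - 1 - (j - 1) = n - j by ring]
    have hs' : Summable (fun j => W (n - j) * (chi δ (j - 1) : ℂ)) := by
      have := (Equiv.subRight (1 : ℤ)).summable_iff.2 (hs (n - 1))
      refine this.congr (fun j => ?_)
      simp only [Function.comp, Equiv.subRight_apply]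
      rw [show n - 1 - (j - 1) = n - j by ring]
    have e2 : W (n - 1) - W n = ∑' j, W (n - j) * ((chi δ (j - 1) - chi δ j : ℝ) : ℂ) := by
      rw [e]
      conv_lhs => rw [← hchi n]
      rw [← hs'.tsum_sub (hs n)]
      congr 1
      funext j
      push_cast
      ring
    rw [e2]
    have e3 : ∀ j, ‖((chi δ (j - 1) - chi δ j : ℝ) : ℂ)‖ = |chi δ (j - 1) - chi δ j| := fun j => by
      rw [Complex.norm_real, Real.norm_eq_abs]
    have h := (conv_bound hβ hW (v := fun j => ((chi δ (j - 1) - chi δ j : ℝ) : ℂ))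
      (by simp_rw [e3]; exact theta_summable hβ1 hδ hδ') n).2
    simp_rw [e3] at h
    rw [mul_comm]
    exact h
  have hpos : ∀ k : ℕ, ∀ n, ‖W (n - k) - W n‖ ≤ k * om β k * theta β δ * (N * om β n) := by
    intro k
    induction k with
    | zero => intro n; simp
    | succ k ih =>
      intro n
      have a1 := h1 (n - k)
      have a2 := ih n
      have e : W (n - ((k + 1 : ℕ) : ℤ)) - W n = (W (n - k - 1) - W (n - k)) + (W (n - k) - W n) := by
        push_cast
        rw [show n - ((k : ℤ) + 1) = n - k - 1 by ring]
        ring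
      rw [e]
      refine (norm_add_le _ _).trans ?_
      have hm : om β (k : ℤ) ≤ om β ((k + 1 : ℕ) : ℤ) := by
        unfold om
        apply Real.rpow_le_rpow (by positivity) _ hβ
        push_cast
        rw [abs_of_nonneg (by positivity), abs_of_nonneg (by positivity)]
        linarith
      have hn := om_pos β n
      have hk := om_pos β k
      have a3 : theta β δ * (N * om β (n - k)) ≤ theta β δ * (N * (om β n * om β k)) := by
        gcongr
        exact om_sub_le hβ _ _
      calc _ ≤ theta β δ * (N * (om β n * om β k)) + k * om β k * theta β δ * (N * om β n) := by linarith
        _ = ((k + 1 : ℕ) : ℝ) * om β k * theta β δ * (N * om β n) := by push_cast; ring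
        _ ≤ _ := by gcongr
  unfold tht
  have hn := om_pos β n
  have hk := om_pos β k
  rw [min_mul_of_nonneg _ _ (by positivity)]
  apply le_min
  · refine (norm_sub_le _ _).trans ?_
    have a1 := hW (n - k)
    have a2 := hW n
    have a3 : N * om β (n - k) ≤ N * (om β n * om β k) := by
      gcongr
      exact om_sub_le hβ _ _
    have a4 : N * om β n * 1 ≤ N * om β n * om β k := by
      gcongr
      exact one_le_om hβ k
    linarith
  · have hk1 := one_le_om hβ k
    rcases Int.le_total 0 k with h | h
    · obtain ⟨m, rfl⟩ := Int.eq_ofNat_of_zero_le h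
      refine (hpos m n).trans ?_
      have : om β m ≤ om β m ^ 2 := by nlinarith
      push_cast
      rw [abs_of_nonneg (by positivity : (0 : ℝ) ≤ m)]
      gcongr
    · obtain ⟨m, hm⟩ := Int.eq_ofNat_of_zero_le (show 0 ≤ -k by omega)
      obtain rfl : k = -(m : ℤ) := by omega
      have a1 := hpos m (n + m)
      rw [add_sub_cancel_right] at a1
      rw [norm_sub_rev, sub_neg_eq_add]
      refine a1.trans ?_
      rw [om_neg] at *
      push_cast
      rw [abs_neg, abs_of_nonneg (by positivity : (0 : ℝ) ≤ m)]
      calc _ ≤ m * om β m * theta β δ * (N * (om β n * om β m)) := by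
            gcongr
            exact om_add_le hβ _ _
        _ = _ := by ring

/-- Local Wiener lemma at the point `0`. -/
lemma local_zero {β δ C κ : ℝ} (hβ : 0 ≤ β) (hβ1 : β < 1) (hδ : 0 < δ) (hδ' : δ ≤ 1) {S c : ℤ → ℂ}
    (hS : ∀ n, ‖S n‖ ≤ C * om β n) (hc : Summable (fun k => om β k * ‖c k‖))
    (hSc : ∀ n, ∑' k, S (n - k) * c k = 0) (hκ : 0 < κ) (hκc : κ ≤ ‖∑' k, c k‖)
    (hth : ∑' k, ‖c k‖ * tht β δ k ≤ κ / 2) :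
    ∑' k, S k * ww δ k = 0 := by
  have hw : Summable (fun j => om β j * ‖(ww δ j : ℂ)‖) := by
    refine (summable_om_ww hβ1 hδ).congr (fun n => ?_)
    rw [Complex.norm_real, Real.norm_eq_abs, abs_of_nonneg (ww_nonneg _ _)]
  set W : ℤ → ℂ := fun n => ∑' k, S (n - k) * (ww δ k : ℂ) with hWdef
  have hC : 0 ≤ C := by
    have := (norm_nonneg _).trans (hS 0)
    rwa [om_zero, mul_one] at this
  have hW0 : ∀ n, ‖W n‖ ≤ (C * ∑' j, om β j * ‖(ww δ j : ℂ)‖) * om β n := by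
    intro n
    have := (conv_bound hβ hS hw n).2
    refine this.trans (le_of_eq (by ring))
  have hchi : ∀ n, ∑' j, W (n - j) * chi δ j = W n := by
    intro n
    rw [hWdef]
    simp only
    rw [conv_assoc hβ hS hw (summable_om_chi hβ1 hδ) n]
    congr 1
    funext k
    rw [(chi_conv hδ hδ' k).tsum_eq]
  have hWc : ∀ n, ∑' k, W (n - k) * c k = 0 := by
    intro n
    rw [hWdef]
    simp only
    rw [conv_assoc hβ hS hw hc n]
    have : ∀ k, ∑' j, (ww δ (k - j) : ℂ) * c j = ∑' j, c (k - j) * (ww δ j : ℂ) :=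
      fun k => conv_comm (fun j => (ww δ j : ℂ)) c k
    simp_rw [this]
    rw [← conv_assoc hβ hS hc hw n]
    simp_rw [hSc]
    simp
  have hc1 : Summable (fun k => ‖c k‖) := by
    refine Summable.of_nonneg_of_le (fun k => norm_nonneg _) (fun k => ?_) hc
    exact le_mul_of_one_le_left (norm_nonneg _) (one_le_om hβ k)
  have step : ∀ N : ℝ, 0 ≤ N → (∀ n, ‖W n‖ ≤ N * om β n) → ∀ n, ‖W n‖ ≤ (N / 2) * om β n := by
    intro N hN hW n
    have hn := om_pos β n
    have e : (∑' k, c k) * W n = - ∑' k, c k * (W (n - k) - W n) := by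
      have h1 : Summable (fun k => c k * W (n - k)) := by
        refine (conv_bound hβ hW hc n).1.congr (fun k => mul_comm _ _)
      have h2 : Summable (fun k => c k * W n) := (Summable.of_norm hc1).mul_right _
      simp_rw [mul_sub]
      rw [h1.tsum_sub h2, tsum_mul_right]
      have := hWc n
      simp_rw [mul_comm (W _) (c _)] at this
      rw [this]
      ring
    have hb : ‖∑' k, c k * (W (n - k) - W n)‖ ≤ (∑' k, ‖c k‖ * tht β δ k) * (N * om β n) := by
      refine tsum_of_norm_bounded ((tht_summable δ hc).hasSum.mul_right (N * om β n)) (fun k => ?_)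
      rw [norm_mul, mul_assoc]
      gcongr
      exact diff_bound hβ hβ1 hδ hδ' hW hN hchi k n
    have h3 : κ * ‖W n‖ ≤ κ / 2 * (N * om β n) := by
      calc κ * ‖W n‖ ≤ ‖∑' k, c k‖ * ‖W n‖ := by gcongr
        _ = ‖∑' k, c k * (W (n - k) - W n)‖ := by rw [← norm_mul, e, norm_neg]
        _ ≤ _ := hb
        _ ≤ _ := by gcongr
    have h4 : κ * ‖W n‖ ≤ κ * ((N / 2) * om β n) := by linarith
    exact le_of_mul_le_mul_left h4 hκ
  have hall : ∀ i : ℕ, ∀ n, ‖W n‖ ≤ ((C * ∑' j, om β j * ‖(ww δ j : ℂ)‖) / 2 ^ i) * om β n := by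
    intro i
    induction i with
    | zero => simpa using hW0
    | succ i ih =>
      have := step _ ?_ ih
      · intro n
        refine (this n).trans (le_of_eq ?_)
        rw [pow_succ]; ring
      · have : 0 ≤ ∑' j, om β j * ‖(ww δ j : ℂ)‖ :=
          tsum_nonneg (fun j => mul_nonneg (om_pos _ _).le (norm_nonneg _))
        positivity
  have hz : W 0 = 0 := by
    rw [← norm_le_zero_iff]
    have h1 : Tendsto (fun i : ℕ => (C * ∑' j, om β j * ‖(ww δ j : ℂ)‖) / 2 ^ i) atTop (𝓝 0) :=
      tendsto_const_nhds.div_atTop (tendsto_pow_atTop_atTop_of_one_lt (by norm_num))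
    refine ge_of_tendsto h1 (Eventually.of_forall (fun i => ?_))
    have := hall i 0
    rwa [om_zero, mul_one] at this
  rw [← hz, hWdef, ← (Equiv.neg ℤ).tsum_eq]
  congr 1
  funext k
  simp [ww_neg]

/-- Local Wiener lemma at a general point. -/
lemma local_pt {β δ C κ : ℝ} (hβ : 0 ≤ β) (hβ1 : β < 1) (hδ : 0 < δ) (hδ' : δ ≤ 1) {S c : ℤ → ℂ}
    (hS : ∀ n, ‖S n‖ ≤ C * om β n) (hc : Summable (fun k => om β k * ‖c k‖))
    (hSc : ∀ n, ∑' k, S (n - k) * c k = 0) (hκ : 0 < κ) (x : AddCircle (2 * π)) (hκc : κ ≤ ‖fSum c x‖)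
    (hth : ∑' k, ‖c k‖ * tht β δ k ≤ κ / 2) :
    fSum (fun n => S n * ww δ n) x = 0 := by
  have e1 : ∀ k, ‖c k * fourier k x‖ = ‖c k‖ := fun k => by rw [norm_mul, norm_fourier_apply, mul_one]
  have h := local_zero (S := fun n => S n * fourier n x) (c := fun k => c k * fourier k x) hβ hβ1 hδ hδ'
    (C := C) (κ := κ) ?_ ?_ ?_ hκ hκc ?_
  · unfold fSum
    rw [← h]
    congr 1
    funext n
    ring
  · intro n
    rw [norm_mul, norm_fourier_apply, mul_one]
    exact hS n
  · simp_rw [e1]; exact hc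
  · intro n
    have : ∀ k, S (n - k) * fourier (n - k) x * (c k * fourier k x) = S (n - k) * c k * fourier n x := by
      intro k
      have : (fourier n x : ℂ) = fourier (n - k) x * fourier k x := by
        rw [← fourier_add, sub_add_cancel]
      rw [this]; ring
    simp_rw [this]
    rw [tsum_mul_right, hSc, zero_mul]
  · simp_rw [e1]; exact hth


lemma cs_tsum {u v : ℤ → ℝ} (hu : Summable (fun n => u n ^ 2)) (hv : Summable (fun n => v n ^ 2)) :
    Summable (fun n => u n * v n) ∧ (∑' n, u n * v n) ^ 2 ≤ (∑' n, u n ^ 2) * ∑' n, v n ^ 2 := by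
  have hs : Summable (fun n => u n * v n) := by
    refine Summable.of_norm_bounded (hu.add hv) (fun n => ?_)
    rw [Real.norm_eq_abs, abs_le]
    constructor <;> nlinarith [sq_nonneg (u n + v n), sq_nonneg (u n - v n)]
  refine ⟨hs, ?_⟩
  have h1 : Tendsto (fun F : Finset ℤ => (∑ n ∈ F, u n * v n) ^ 2) atTop (𝓝 ((∑' n, u n * v n) ^ 2)) :=
    hs.hasSum.pow 2
  refine le_of_tendsto' h1 (fun F => ?_)
  refine (Finset.sum_mul_sq_le_sq_mul_sq F u v).trans ?_
  exact mul_le_mul (hu.sum_le_tsum F (fun n _ => sq_nonneg _)) (hv.sum_le_tsum F (fun n _ => sq_nonneg _))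
    (Finset.sum_nonneg (fun n _ => sq_nonneg _)) (tsum_nonneg (fun n => sq_nonneg _))

lemma rec_step {g h : ℤ → ℂ} (hg : Summable (fun n => ‖g n‖)) (hh : Summable (fun n => ‖h n‖))
    (y : AddCircle (2 * π)) :
    fSum (fun n => g (-n) * h n) y = ∫ x, fSum g x * fSum h (x + y) ∂haar := by
  have h1 := intSum (G := fSum g)
    ((continuous_fSum hg).integrable_of_hasCompactSupport (HasCompactSupport.of_compactSpace _))
    (a := fun n => h n * fourier n y) (by
      refine hh.congr (fun n => ?_)
      rw [norm_mul, norm_fourier_apply, mul_one])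
  have e : ∀ x, fSum (fun n => h n * fourier n y) x = fSum h (x + y) := by
    intro x
    unfold fSum
    congr 1
    funext n
    rw [show (fourier n (x + y) : ℂ) = fourier n x * fourier n y by
      rw [fourier_apply, fourier_apply, fourier_apply, smul_add, AddCircle.toCircle_add]; rfl]
    ring
  simp_rw [e] at h1
  rw [← h1.tsum_eq]
  have := coef_fSum hg
  have e2 : ∀ n t, fourier n t * fSum g t = fSum g t * fourier n t := fun n t => mul_comm _ _
  have e3 : ∀ n : ℤ, ∫ t, fSum g t * fourier n t ∂haar = g (-n) := by
    intro n
    rw [← this (-n), neg_neg]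
    simp only [e2, mul_comm]
  simp_rw [e3]
  show ∑' n : ℤ, g (-n) * h n * fourier n y = _
  refine tsum_congr (fun n => ?_)
  ring

lemma rec_sum {g : ℤ → ℂ} (hg : Summable (fun n => ‖g n‖)) (A : Set (AddCircle (2 * π)))
    (hA : ∀ x, x ∉ A → fSum g x = 0) (m : ℕ) : ∀ h : ℤ → ℂ, Summable (fun n => ‖h n‖) →
    (∀ a : Fin m → AddCircle (2 * π), (∀ i, a i ∈ A) → fSum h (∑ i, a i) = 0) →
    ∑' n, g (-n) ^ m * h n = 0 := by
  induction m with
  | zero =>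
    intro h hh hz
    have := hz (fun i => 0) (fun i => i.elim0)
    simpa [fSum] using this
  | succ m ih =>
    intro h hh hz
    have hb : ∀ n, ‖g n‖ ≤ ∑' n, ‖g n‖ := fun n => hg.le_tsum n (fun _ _ => norm_nonneg _)
    have hh' : Summable (fun n => ‖g (-n) * h n‖) := by
      refine Summable.of_nonneg_of_le (fun n => norm_nonneg _) (fun n => ?_) (hh.mul_left (∑' n, ‖g n‖))
      rw [norm_mul]
      gcongr
      exact hb _
    have := ih (fun n => g (-n) * h n) hh' ?_
    · rw [← this]
      congr 1
      funext n
      ring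
    · intro a ha
      rw [rec_step hg hh]
      rw [integral_eq_zero_of_ae]
      refine ae_of_all _ (fun x => ?_)
      by_cases hx : x ∈ A
      · have := hz (Fin.cons x a) (fun i => by
          refine Fin.cases ?_ (fun j => ?_) i
          · simpa using hx
          · simpa using ha j)
        rw [Fin.sum_univ_succ] at this
        simp only [Fin.cons_zero, Fin.cons_succ] at this
        simp [this]
      · simp [hA x hx]

lemma parseval_ind {A : Set (AddCircle (2 * π))} (hA : MeasurableSet A) :
    HasSum (fun n => ‖fourierCoeff (A.indicator (fun _ => (1 : ℂ))) n‖ ^ 2) (haar A).toReal := by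
  have hm : MemLp (A.indicator (fun _ => (1 : ℂ))) 2 haar :=
    memLp_indicator_const 2 hA 1 (Or.inr (measure_ne_top _ _))
  have h := hasSum_sq_fourierCoeff (T := 2 * π) hm.toLp
  have e := hm.coeFn_toLp
  refine hs_congr h (fun n => ?_) ?_
  · rw [fourierCoeff_congr_ae e]
  · have : ∫ t, ‖hm.toLp _ t‖ ^ 2 ∂haar = ∫ t, A.indicator (fun _ => (1 : ℝ)) t ∂haar := by
      apply integral_congr_ae
      filter_upwards [e] with t ht
      rw [ht]
      by_cases hx : t ∈ A <;> simp [hx]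
    rw [this, integral_indicator hA]
    simp [Measure.real]

/-- The Fourier coefficients of the mollified indicator. -/
def bb (ℓ : ℝ) (A : Set (AddCircle (2 * π))) (n : ℤ) : ℂ :=
  fourierCoeff (A.indicator (fun _ => (1 : ℂ))) n * ww ℓ n

lemma bb_summable {ℓ : ℝ} (hℓ : 0 < ℓ) {A : Set (AddCircle (2 * π))} (hA : MeasurableSet A) :
    Summable (fun n => ‖bb ℓ A n‖) := by
  have h := (cs_tsum (u := fun n => ‖fourierCoeff (A.indicator (fun _ => (1 : ℂ))) n‖) (v := ww ℓ)
    (parseval_ind hA).summable ?_).1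
  · refine h.congr (fun n => ?_)
    unfold bb
    rw [norm_mul, Complex.norm_real, Real.norm_eq_abs, abs_of_nonneg (ww_nonneg _ _)]
  · refine Summable.of_nonneg_of_le (fun n => sq_nonneg _) (fun n => ?_) (summable_ww hℓ)
    have := ww_nonneg ℓ n
    have := ww_le_one ℓ n
    nlinarith

lemma fSum_bb {ℓ : ℝ} (hℓ : 0 < ℓ) (hℓ1 : ℓ ≤ 1) {A : Set (AddCircle (2 * π))} (hA : MeasurableSet A)
    (x : AddCircle (2 * π)) (hx : Metric.ball x ℓ ⊆ A) : fSum (bb ℓ A) x = 1 := by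
  have hpi := Real.pi_gt_three
  have hw : Summable (fun n => ‖(ww ℓ n : ℂ)‖) := by
    refine (summable_ww hℓ).congr (fun n => ?_)
    rw [Complex.norm_real, Real.norm_eq_abs, abs_of_nonneg (ww_nonneg _ _)]
  have ha : Summable (fun n => ‖(ww ℓ n : ℂ) * fourier n (-x)‖) := by
    refine hw.congr (fun n => ?_)
    rw [norm_mul, norm_fourier_apply, mul_one]
  have hG : Integrable (A.indicator (fun _ => (1 : ℂ))) haar :=
    (integrable_const 1).indicator hA
  have h := intSum hG ha
  have e : ∀ t, fSum (fun n => (ww ℓ n : ℂ) * fourier n (-x)) t = fSum (fun n => (ww ℓ n : ℂ)) (t - x) := by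
    intro t
    unfold fSum
    congr 1
    funext n
    rw [show (fourier n (t - x) : ℂ) = fourier n t * fourier n (-x) by
      rw [sub_eq_add_neg, fourier_apply, fourier_apply, fourier_apply, smul_add, AddCircle.toCircle_add]; rfl]
    ring
  have e2 : ∫ t, A.indicator (fun _ => (1 : ℂ)) t * fSum (fun n => (ww ℓ n : ℂ) * fourier n (-x)) t ∂haar = 1 := by
    have h0 := coef_fSum ha 0
    rw [ww_zero] at h0
    simp only [neg_zero, fourier_zero, one_mul, Complex.ofReal_one] at h0
    refine Eq.trans ?_ h0
    congr 1
    funext t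
    by_cases ht : t ∈ A
    · rw [Set.indicator_of_mem ht, one_mul]
    · rw [Set.indicator_of_notMem ht, zero_mul, e t, fSum_ww_zero ℓ hℓ (by linarith)]
      by_contra hc
      apply ht
      apply hx
      rw [mem_ball_iff_norm]
      linarith
  rw [e2] at h
  rw [← h.tsum_eq, ← (Equiv.neg ℤ).tsum_eq]
  unfold fSum
  congr 1
  funext n
  unfold bb fourierCoeff
  simp only [Equiv.neg_apply, smul_eq_mul, ww_neg]
  have e3 : (fourier (-n) (-x) : ℂ) = fourier n x := by
    rw [fourier_apply, fourier_apply, neg_smul, smul_neg, neg_neg]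
  rw [e3]
  have e4 : ∀ t, (fourier (-n) t : ℂ) * A.indicator (fun _ => (1 : ℂ)) t = A.indicator (fun _ => (1 : ℂ)) t * fourier (-n) t :=
    fun t => mul_comm _ _
  simp_rw [e4]
  ring

lemma ww_om_le {ℓ γ : ℝ} (hℓ : 0 < ℓ) (hℓ1 : ℓ ≤ 1) (hγ : 0 ≤ γ) (hγ1 : γ ≤ 1) (n : ℤ) :
    (om γ n * ww ℓ n) ^ 2 ≤ 9 * ℓ ^ (-(2 * γ)) := by
  have h0 := ww_nonneg ℓ n
  have h1 := ww_le_one ℓ n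
  have h2 := ww_le ℓ n
  set s := ℓ * |(n : ℝ)| with hs
  have hs0 : 0 ≤ s := by positivity
  have h3 : ww ℓ n * s ^ 2 ≤ 4 := by
    rw [hs, mul_pow, sq_abs, ← mul_pow]; exact h2
  have h4 : (1 + s) * ww ℓ n ≤ 3 := by
    rcases le_total s 2 with h | h
    · nlinarith
    · nlinarith
  have h5 : ℓ ^ γ * om γ n ≤ 1 + s := by
    unfold om
    rw [← Real.mul_rpow hℓ.le (by positivity)]
    calc _ ≤ (1 + s) ^ γ := by
          apply Real.rpow_le_rpow (by positivity) _ hγ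
          rw [hs]; nlinarith
      _ ≤ (1 + s) ^ (1 : ℝ) := Real.rpow_le_rpow_of_exponent_le (by linarith) hγ1
      _ = _ := Real.rpow_one _
  have h6 : ℓ ^ γ * (om γ n * ww ℓ n) ≤ 3 := by
    calc _ = (ℓ ^ γ * om γ n) * ww ℓ n := by ring
      _ ≤ (1 + s) * ww ℓ n := by gcongr
      _ ≤ 3 := h4
  have hl : 0 < ℓ ^ γ := by positivity
  rw [Real.rpow_neg hℓ.le, show 2 * γ = γ * 2 by ring, Real.rpow_mul hℓ.le, ← div_eq_mul_inv]
  norm_num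
  rw [le_div_iff₀ (by positivity)]
  have h7 : 0 ≤ ℓ ^ γ * (om γ n * ww ℓ n) := by
    have := om_pos γ n
    positivity
  nlinarith

lemma core {m : ℕ} {γ ℓ : ℝ} (hγ : 0 ≤ γ) (hγ1 : γ ≤ 1) (hℓ : 0 < ℓ) (hℓ1 : ℓ ≤ 1) {S g : ℤ → ℂ}
    (hT : Summable (fun n => ‖S n‖ ^ (2 * m) * om (-(2 * γ)) n)) (hg : Summable (fun n => ‖g n‖))
    (hgS : ∀ n, ‖g n‖ ≤ ‖S n‖) (hg0 : g 0 = S 0)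
    {A A' : Set (AddCircle (2 * π))} (hA : ∀ x, x ∉ A → fSum g x = 0) (hA' : MeasurableSet A')
    (hAA : ∀ a : Fin m → AddCircle (2 * π), (∀ i, a i ∈ A) → Metric.ball (∑ i, a i) ℓ ⊆ A') :
    (‖S 0‖ ^ m) ^ 2 ≤ (∑' n, ‖S n‖ ^ (2 * m) * om (-(2 * γ)) n) * (9 * ℓ ^ (-(2 * γ)) * (haar A').toReal) := by
  have hb := bb_summable hℓ hA'
  have hδ : Summable (fun n : ℤ => ‖(if n = 0 then (1 : ℂ) else 0)‖) := by
    apply summable_of_ne_finset_zero (s := {0})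
    intro n hn
    simp at hn
    simp [hn]
  have hh : Summable (fun n : ℤ => ‖(if n = 0 then (1 : ℂ) else 0) - bb ℓ A' n‖) :=
    Summable.of_nonneg_of_le (fun n => norm_nonneg _) (fun n => norm_sub_le _ _) (hδ.add hb)
  have hbd : ∀ n, ‖g n‖ ≤ ∑' n, ‖g n‖ := fun n => hg.le_tsum n (fun _ _ => norm_nonneg _)
  have h1 := rec_sum hg A hA m (fun n => (if n = 0 then (1 : ℂ) else 0) - bb ℓ A' n) hh ?_
  · have hs1 : Summable (fun n : ℤ => g (-n) ^ m * (if n = 0 then (1 : ℂ) else 0)) := by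
      apply summable_of_ne_finset_zero (s := {0})
      intro n hn
      simp at hn
      simp [hn]
    have hs2n : Summable (fun n : ℤ => ‖g (-n) ^ m * bb ℓ A' n‖) := by
      refine Summable.of_nonneg_of_le (fun n => norm_nonneg _) (fun n => ?_)
        (hb.mul_left ((∑' n, ‖g n‖) ^ m))
      rw [norm_mul, norm_pow]
      gcongr
      exact hbd _
    have hs2 := Summable.of_norm hs2n
    simp_rw [mul_sub] at h1
    rw [hs1.tsum_sub hs2, sub_eq_zero] at h1
    have e1 : ∑' n : ℤ, g (-n) ^ m * (if n = 0 then (1 : ℂ) else 0) = S 0 ^ m := by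
      rw [tsum_eq_single 0]
      · simp [hg0]
      · intro n hn; simp [hn]
    rw [e1] at h1
    set co := fun n => ‖fourierCoeff (A'.indicator (fun _ => (1 : ℂ))) n‖ with hco
    have hu : Summable (fun n => (‖S (-n)‖ ^ m * om (-γ) n) ^ 2) := by
      have := (Equiv.neg ℤ).summable_iff.2 hT
      refine this.congr (fun n => ?_)
      simp only [Function.comp, Equiv.neg_apply]
      rw [om_neg, mul_pow, ← pow_mul, mul_comm m 2, sq (om (-γ) n), om_mul_om]
      congr 2
      ring
    have hue : ∑' n, (‖S (-n)‖ ^ m * om (-γ) n) ^ 2 = ∑' n, ‖S n‖ ^ (2 * m) * om (-(2 * γ)) n := by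
      rw [← (Equiv.neg ℤ).tsum_eq (fun n => ‖S n‖ ^ (2 * m) * om (-(2 * γ)) n)]
      congr 1
      funext n
      simp only [Equiv.neg_apply]
      rw [om_neg, mul_pow, ← pow_mul, mul_comm m 2, sq (om (-γ) n), om_mul_om]
      congr 2
      ring
    have hp := parseval_ind hA'
    have hvb : ∀ n, (om γ n * ‖bb ℓ A' n‖) ^ 2 ≤ 9 * ℓ ^ (-(2 * γ)) * co n ^ 2 := by
      intro n
      unfold bb
      rw [norm_mul, Complex.norm_real, Real.norm_eq_abs, abs_of_nonneg (ww_nonneg _ _)]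
      calc _ = (om γ n * ww ℓ n) ^ 2 * co n ^ 2 := by rw [hco]; ring
        _ ≤ _ := by
          gcongr
          exact ww_om_le hℓ hℓ1 hγ hγ1 n
    have hv := Summable.of_nonneg_of_le (fun n => sq_nonneg _) hvb (hp.summable.mul_left (9 * ℓ ^ (-(2 * γ))))
    have hve : ∑' n, (om γ n * ‖bb ℓ A' n‖) ^ 2 ≤ 9 * ℓ ^ (-(2 * γ)) * (haar A').toReal := by
      rw [← hp.tsum_eq, ← tsum_mul_left]
      exact hv.tsum_le_tsum hvb (hp.summable.mul_left (9 * ℓ ^ (-(2 * γ))))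
    obtain ⟨hcs, hcs2⟩ := cs_tsum hu hv
    have hn : ‖S 0‖ ^ m ≤ ∑' n, (‖S (-n)‖ ^ m * om (-γ) n) * (om γ n * ‖bb ℓ A' n‖) := by
      rw [← norm_pow, h1]
      refine tsum_of_norm_bounded hcs.hasSum (fun n => ?_)
      rw [norm_mul, norm_pow]
      have : om (-γ) n * om γ n = 1 := by rw [om_mul_om]; simp [om]
      calc _ ≤ ‖S (-n)‖ ^ m * ‖bb ℓ A' n‖ := by
            gcongr
            exact hgS _
        _ = ‖S (-n)‖ ^ m * (om (-γ) n * om γ n) * ‖bb ℓ A' n‖ := by rw [this, mul_one]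
        _ = _ := by ring
    calc _ ≤ (∑' n, (‖S (-n)‖ ^ m * om (-γ) n) * (om γ n * ‖bb ℓ A' n‖)) ^ 2 := by gcongr
      _ ≤ _ := hcs2
      _ ≤ _ := by
        rw [hue]
        gcongr
        exact tsum_nonneg (fun n => mul_nonneg (by positivity) (om_pos _ _).le)
  · intro a ha
    have h2 := fSum_bb hℓ hℓ1 hA' _ (hAA a ha)
    have h3 : fSum (fun n => if n = 0 then (1 : ℂ) else 0) (∑ i, a i) = 1 := by
      unfold fSum
      rw [tsum_eq_single 0]
      · simp
      · intro n hn; simp [hn]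
    refine Eq.trans ?_ (sub_eq_zero.2 (h3.trans h2.symm))
    unfold fSum
    rw [← (summable_fSum hδ _).tsum_sub (summable_fSum hb _)]
    congr 1
    funext n
    ring


/-- Covering condition for the `m`-fold sum set of `E`. -/
def Cov (m : ℕ) (γ : ℝ) (E : Set (AddCircle (2 * π))) : Prop :=
  ∀ ε : ℝ, 0 < ε → ∃ ℓ : ℝ, 0 < ℓ ∧ ℓ ≤ 1 ∧ ∃ D : Finset (AddCircle (2 * π)),
    D.card * ℓ ^ (1 - 2 * γ) ≤ ε ∧
    ∀ x : Fin m → AddCircle (2 * π), (∀ i, x i ∈ E) → ∃ d ∈ D, dist (∑ i, x i) d ≤ ℓ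

lemma haar_ball (x : AddCircle (2 * π)) {r : ℝ} (hr : 0 ≤ r) :
    haar (Metric.closedBall x r) ≤ ENNReal.ofReal r := by
  have hpi := Real.pi_gt_three
  have h := AddCircle.volume_closedBall (2 * π) (x := x) r
  rw [AddCircle.volume_eq_smul_haarAddCircle, Measure.smul_apply, smul_eq_mul] at h
  have h2 : ENNReal.ofReal (2 * π) * haar (Metric.closedBall x r) ≤ ENNReal.ofReal (2 * π) * ENNReal.ofReal r := by
    rw [h, ← ENNReal.ofReal_mul (by positivity)]
    apply ENNReal.ofReal_le_ofReal
    refine (min_le_right _ _).trans ?_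
    nlinarith
  exact (ENNReal.mul_le_mul_iff_right (by simp; positivity) ENNReal.ofReal_ne_top).1 h2

lemma cov_zero {m : ℕ} {β γ C : ℝ} (hβ : 0 ≤ β) (hβ1 : β < 1) (hγ : 0 ≤ γ) (hγ1 : γ ≤ 1)
    {S c : ℤ → ℂ} (hS : ∀ n, ‖S n‖ ≤ C * om β n) (hc : Summable (fun k => om β k * ‖c k‖))
    (hSc : ∀ n, ∑' k, S (n - k) * c k = 0)
    (hT : Summable (fun n => ‖S n‖ ^ (2 * m) * om (-(2 * γ)) n))
    (hE : Cov m γ (zeroSet c)) : S 0 = 0 := by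
  set E := zeroSet c with hEd
  set T := ∑' n, ‖S n‖ ^ (2 * m) * om (-(2 * γ)) n with hTd
  have hT0 : 0 ≤ T := tsum_nonneg (fun n => mul_nonneg (by positivity) (om_pos _ _).le)
  have hc1 : Summable (fun k => ‖c k‖) := by
    refine Summable.of_nonneg_of_le (fun n => norm_nonneg _) (fun n => ?_) hc
    have := one_le_om hβ n
    nlinarith [norm_nonneg (c n)]
  have key : ∀ ε : ℝ, 0 < ε → (‖S 0‖ ^ m) ^ 2 ≤ (T * (9 * (m + 2))) * ε := by
    intro ε hε
    obtain ⟨ℓ, hℓ, hℓ1, D, hD, hcov⟩ := hE ε hε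
    set A := Metric.thickening ℓ E with hAd
    have hEA : E ⊆ A := Metric.self_subset_thickening hℓ E
    obtain ⟨κ, hκ, hκc⟩ : ∃ κ : ℝ, 0 < κ ∧ ∀ x ∈ Aᶜ, κ ≤ ‖fSum c x‖ := by
      have hK : IsCompact Aᶜ := Metric.isOpen_thickening.isClosed_compl.isCompact
      rcases Set.eq_empty_or_nonempty Aᶜ with h | h
      · exact ⟨1, one_pos, by simp [h]⟩
      · obtain ⟨x, hx, hmin⟩ := hK.exists_isMinOn h (continuous_fSum hc1).norm.continuousOn
        refine ⟨‖fSum c x‖, ?_, fun y hy => hmin hy⟩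
        rw [norm_pos_iff]
        intro h0
        exact hx (hEA h0)
    obtain ⟨δ, hδ, hδ1, hth⟩ := exists_delta hβ1 hc (half_pos hκ)
    have hg : Summable (fun n => ‖S n * (ww δ n : ℂ)‖) := by
      refine Summable.of_nonneg_of_le (fun n => norm_nonneg _) (fun n => ?_)
        ((summable_om_ww hβ1 hδ).mul_left C)
      rw [norm_mul, Complex.norm_real, Real.norm_eq_abs, abs_of_nonneg (ww_nonneg _ _), ← mul_assoc]
      exact mul_le_mul_of_nonneg_right (hS n) (ww_nonneg _ _)
    set A' : Set (AddCircle (2 * π)) := ⋃ d ∈ D, Metric.closedBall d ((m + 2) * ℓ) with hA'd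
    have h := core (m := m) hγ hγ1 hℓ hℓ1 hT hg (g := fun n => S n * (ww δ n : ℂ)) (A := A) (A' := A') ?_ ?_ ?_ ?_ ?_
    · have hm : (haar A').toReal ≤ D.card * ((m + 2) * ℓ) := by
        have h1 : haar A' ≤ ∑ d ∈ D, haar (Metric.closedBall d ((m + 2) * ℓ)) :=
          measure_biUnion_finset_le _ _
        have h2 : ∑ d ∈ D, haar (Metric.closedBall d ((m + 2) * ℓ)) ≤ ∑ d ∈ D, ENNReal.ofReal ((m + 2) * ℓ) :=
          Finset.sum_le_sum (fun d _ => haar_ball d (by positivity))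
        rw [Finset.sum_const, nsmul_eq_mul] at h2
        have h3 := ENNReal.toReal_mono (by finiteness) (h1.trans h2)
        rwa [ENNReal.toReal_mul, ENNReal.toReal_ofReal (by positivity), ENNReal.toReal_natCast] at h3
      have e : ℓ ^ (1 - 2 * γ) = ℓ * ℓ ^ (-(2 * γ)) := by
        rw [sub_eq_add_neg, Real.rpow_add hℓ, Real.rpow_one]
      calc _ ≤ _ := h
        _ ≤ T * (9 * ℓ ^ (-(2 * γ)) * (D.card * ((m + 2) * ℓ))) := by gcongr
        _ = (T * (9 * (m + 2))) * (D.card * ℓ ^ (1 - 2 * γ)) := by rw [e]; ring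
        _ ≤ _ := by gcongr
    · intro n
      rw [norm_mul, Complex.norm_real, Real.norm_eq_abs, abs_of_nonneg (ww_nonneg _ _)]
      exact mul_le_of_le_one_right (norm_nonneg _) (ww_le_one _ _)
    · simp [ww_zero]
    · intro x hx
      exact local_pt hβ hβ1 hδ hδ1 hS hc hSc hκ x (hκc x hx) hth
    · exact Finset.measurableSet_biUnion _ (fun d _ => Metric.isClosed_closedBall.measurableSet)
    · intro a ha y hy
      have : ∀ i, ∃ e ∈ E, dist (a i) e < ℓ := fun i => Metric.mem_thickening_iff.1 (ha i)
      choose e he hae using this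
      obtain ⟨d, hd, hdd⟩ := hcov e he
      refine Set.mem_biUnion (show d ∈ (D : Set _) from hd) ?_
      rw [Metric.mem_closedBall]
      have h1 : dist (∑ i, a i) (∑ i, e i) ≤ ∑ i : Fin m, ℓ :=
        dist_sum_sum_le_of_le _ (fun i _ => (hae i).le)
      simp only [Finset.sum_const, Finset.card_univ, Fintype.card_fin, nsmul_eq_mul] at h1
      have h2 := Metric.mem_ball.1 hy
      have h3 := dist_triangle4 y (∑ i, a i) (∑ i, e i) d
      linarith
  have h0 : (‖S 0‖ ^ m) ^ 2 ≤ 0 := by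
    by_contra hh
    push Not at hh
    set X := (‖S 0‖ ^ m) ^ 2 with hX
    set Y := T * (9 * ((m : ℝ) + 2)) with hY
    have hY0 : 0 ≤ Y := by positivity
    have := key (X / (2 * (Y + 1))) (by positivity)
    rw [mul_div_assoc', le_div_iff₀ (by positivity)] at this
    nlinarith
  have h1 : (‖S 0‖ ^ m) ^ 2 = 0 := le_antisymm h0 (sq_nonneg _)
  have h2 := pow_eq_zero_iff (two_ne_zero) |>.1 h1
  exact norm_eq_zero.1 (eq_zero_of_pow_eq_zero h2)


lemma exists_functional {V : Type*} [NormedAddCommGroup V] [NormedSpace ℂ V] (W : Submodule ℂ V) (x : V)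
    (hx : x ∉ closure (W : Set V)) : ∃ L : V →L[ℂ] ℂ, (∀ w ∈ W, L w = 0) ∧ L x ≠ 0 := by
  set W' := W.topologicalClosure with hW'
  have : IsClosed (W' : Set V) := W.isClosed_topologicalClosure
  have hx' : x ∉ W' := hx
  have h0 : ‖W'.mkQ x‖ ≠ 0 := by
    rw [norm_ne_zero_iff]
    intro h
    exact hx' ((Submodule.Quotient.mk_eq_zero W').1 h)
  obtain ⟨g, -, hg⟩ := exists_dual_vector ℂ (W'.mkQ x) h0
  refine ⟨g.comp W'.mkQL, fun w hw => ?_, ?_⟩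
  · have : W'.mkQL w = 0 := (Submodule.Quotient.mk_eq_zero W').2 (W.le_topologicalClosure hw)
    simp [this]
  · show g (W'.mkQ x) ≠ 0
    rw [hg]
    intro hh
    exact h0 (by simpa using hh)

lemma summable_of_memA {β : ℝ} {c : ℤ → ℂ} (hc : MemA 1 β c) : Summable (fun k => om β k * ‖c k‖) := by
  refine Summable.congr hc (fun n => ?_)
  rw [Real.rpow_one, one_mul, mul_comm]
  rfl

lemma dual_sum {p q : ℝ} (hp1 : 1 < p) (hp2 : p < 2) (hq : q = p / (p - 1)) [Fact (1 ≤ ENNReal.ofReal p)]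
    (L : lp (fun _ : ℤ => ℂ) (ENNReal.ofReal p) →L[ℂ] ℂ) :
    Summable (fun n : ℤ => ‖L (lp.single (ENNReal.ofReal p) n (1 : ℂ))‖ ^ q) := by
  have hp0 : 0 < p := by linarith
  have hpr : (ENNReal.ofReal p).toReal = p := ENNReal.toReal_ofReal hp0.le
  have hq2 : 2 < q := by
    rw [hq, lt_div_iff₀ (by linarith)]; linarith
  have hpq : (q - 1) * p = q := by
    rw [hq]; have : p - 1 ≠ 0 := by linarith
    field_simp; ring
  set t := fun n : ℤ => L (lp.single (ENNReal.ofReal p) n (1 : ℂ)) with ht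
  refine summable_of_sum_le (c := ‖L‖ ^ q) (fun n => by positivity) (fun F => ?_)
  set N := ∑ n ∈ F, ‖t n‖ ^ q with hN
  have hN0 : 0 ≤ N := Finset.sum_nonneg (fun n _ => by positivity)
  rcases hN0.eq_or_lt with h0 | hNpos
  · show N ≤ _
    rw [← h0]; positivity
  set y : ℤ → ℂ := fun n => (starRingEnd ℂ) (t n) * ((‖t n‖ ^ (q - 2) : ℝ) : ℂ) with hy
  have hyn : ∀ n, ‖y n‖ ^ p = ‖t n‖ ^ q := by
    intro n
    rw [hy]
    simp only [norm_mul, RCLike.norm_conj, Complex.norm_real]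
    rw [Real.norm_eq_abs, abs_of_nonneg (by positivity)]
    rcases (norm_nonneg (t n)).eq_or_lt with h | h
    · rw [← h, zero_mul, Real.zero_rpow hp0.ne', Real.zero_rpow (by linarith)]
    · have : ‖t n‖ * ‖t n‖ ^ (q - 2) = ‖t n‖ ^ (q - 1) := by
        nth_rewrite 1 [← Real.rpow_one ‖t n‖]
        rw [← Real.rpow_add h]; congr 1; ring
      rw [this, ← Real.rpow_mul h.le, hpq]
  have hyt : ∀ n, y n * t n = ((‖t n‖ ^ q : ℝ) : ℂ) := by
    intro n
    rw [hy]
    simp only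
    rw [mul_right_comm, mul_comm ((starRingEnd ℂ) (t n)), Complex.mul_conj, ← Complex.ofReal_mul,
      Complex.normSq_eq_norm_sq]
    rcases (norm_nonneg (t n)).eq_or_lt with h | h
    · rw [← h, Real.zero_rpow (show q ≠ 0 by linarith)]; simp
    · rw [← Real.rpow_two, ← Real.rpow_add h]; congr 2; ring
  set x := ∑ n ∈ F, lp.single (E := fun _ : ℤ => ℂ) (ENNReal.ofReal p) n (y n) with hx
  have hLx : L x = ((N : ℝ) : ℂ) := by
    rw [hx, map_sum, hN, Complex.ofReal_sum]
    refine Finset.sum_congr rfl (fun n _ => ?_)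
    rw [← hyt n]
    have : lp.single (E := fun _ : ℤ => ℂ) (ENNReal.ofReal p) n (y n) = y n • lp.single (E := fun _ : ℤ => ℂ) (ENNReal.ofReal p) n 1 := by
      rw [← lp.single_smul]; simp
    rw [this, map_smul, smul_eq_mul]
  have hxn : ‖x‖ ^ p = N := by
    have := lp.norm_sum_single (E := fun _ : ℤ => ℂ) (p := ENNReal.ofReal p) (by rw [hpr]; exact hp0) y F
    rw [hpr] at this
    rw [hx, this]
    exact Finset.sum_congr rfl (fun n _ => hyn n)
  have hb := L.le_opNorm x
  rw [hLx, Complex.norm_real, Real.norm_eq_abs, abs_of_nonneg hN0] at hb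
  have hx0 : 0 < ‖x‖ := by
    rcases (norm_nonneg x).eq_or_lt with h | h
    · rw [← h, Real.zero_rpow hp0.ne'] at hxn; linarith
    · exact h
  have h3 : ‖x‖ ^ (p - 1) ≤ ‖L‖ := by
    rw [← hxn] at hb
    rw [Real.rpow_sub hx0, Real.rpow_one, div_le_iff₀ hx0]
    exact hb
  show N ≤ _
  calc N = (‖x‖ ^ (p - 1)) ^ q := by
        rw [← Real.rpow_mul hx0.le, ← hxn, hq]
        congr 1
        have : p - 1 ≠ 0 := by linarith
        field_simp
    _ ≤ _ := Real.rpow_le_rpow (by positivity) h3 (by linarith)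

lemma dual {p q β : ℝ} (hp1 : 1 < p) (hp2 : p < 2) (hq : q = p / (p - 1)) (hβ : 0 ≤ β) {c : ℤ → ℂ}
    (hc : MemA 1 β c) (hn : ¬ IsCyclicA p β c) :
    ∃ S : ℤ → ℂ, S 0 ≠ 0 ∧ (∀ n, ∑' k, S (n - k) * c k = 0) ∧
      Summable (fun n => (‖S n‖ * om (-β) n) ^ q) := by
  have hp0 : 0 < p := by linarith
  have hpr : (ENNReal.ofReal p).toReal = p := ENNReal.toReal_ofReal hp0.le
  have hP1 : 1 ≤ ENNReal.ofReal p := by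
    rw [← ENNReal.ofReal_one]; exact ENNReal.ofReal_le_ofReal hp1.le
  have : Fact (1 ≤ ENNReal.ofReal p) := ⟨hP1⟩
  have hc' := summable_of_memA hc
  have hmem : ∀ j : ℤ, Memℓp (E := fun _ : ℤ => ℂ) (fun n => c (n - j) * (om β n : ℂ)) (ENNReal.ofReal p) := by
    intro j
    refine Memℓp.of_exponent_ge (q := 1) ?_ hP1
    refine memℓp_gen ?_
    simp only [ENNReal.toReal_one, Real.rpow_one]
    have h1 := ((Equiv.subRight j).summable_iff.2 hc').mul_left (om β j)
    refine Summable.of_nonneg_of_le (fun n => norm_nonneg _) (fun n => ?_) h1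
    simp only [Function.comp, Equiv.subRight_apply]
    rw [norm_mul, Complex.norm_real, Real.norm_eq_abs, abs_of_pos (om_pos _ _)]
    have := om_add_le hβ j (n - j)
    rw [add_sub_cancel] at this
    nlinarith [norm_nonneg (c (n - j))]
  set v : ℤ → lp (fun _ : ℤ => ℂ) (ENNReal.ofReal p) := fun j => ⟨_, hmem j⟩ with hv
  have hvn : ∀ j n, v j n = c (n - j) * (om β n : ℂ) := fun j n => rfl
  set W := Submodule.span ℂ (Set.range v) with hW
  set e0 := lp.single (E := fun _ : ℤ => ℂ) (ENNReal.ofReal p) 0 1 with he0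
  by_cases hcl : e0 ∈ closure (W : Set (lp (fun _ : ℤ => ℂ) (ENNReal.ofReal p)))
  · exfalso
    apply hn
    intro ε hε
    obtain ⟨w, hw, hd⟩ := Metric.mem_closure_iff.1 hcl ε hε
    obtain ⟨a, ha⟩ := Finsupp.mem_span_range_iff_exists_finsupp.1 hw
    refine ⟨a, ?_, ?_⟩
    · exact a.hasFiniteSupport
    · have hwn : ∀ n, w n = convSeq a c n * (om β n : ℂ) := by
        intro n
        rw [← ha, Finsupp.sum, lp.coeFn_sum, Finset.sum_apply]
        unfold convSeq
        rw [tsum_eq_sum (s := a.support), Finset.sum_mul]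
        · refine Finset.sum_congr rfl (fun i _ => ?_)
          rw [lp.coeFn_smul, Pi.smul_apply, hvn, smul_eq_mul]
          ring
        · intro k hk
          rw [Finsupp.notMem_support_iff.1 hk, zero_mul]
      rw [dist_eq_norm, lp.norm_eq_tsum_rpow (by rw [hpr]; exact hp0), hpr] at hd
      refine lt_of_eq_of_lt ?_ hd
      unfold normA wSum
      congr 1
      refine tsum_congr (fun n => ?_)
      have : (e0 - w) n = ((if n = 0 then 1 else 0) - convSeq a c n) * (om β n : ℂ) := by
        rw [lp.coeFn_sub, Pi.sub_apply, hwn, he0, lp.coeFn_single]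
        by_cases h : n = 0
        · subst h
          simp [om_zero]
        · simp [h]
      rw [this, norm_mul, Complex.norm_real, Real.norm_eq_abs, abs_of_pos (om_pos _ _),
        Real.mul_rpow (norm_nonneg _) (om_pos _ _).le]
      congr 1
      unfold om
      rw [← Real.rpow_mul (by positivity), mul_comm]
  · obtain ⟨L, hL, hL0⟩ := exists_functional W e0 hcl
    have hsum := dual_sum hp1 hp2 hq L
    set t := fun n : ℤ => L (lp.single (ENNReal.ofReal p) n (1 : ℂ)) with ht
    refine ⟨fun n => (om β n : ℂ) * t (-n), ?_, ?_, ?_⟩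
    · simp only [neg_zero, om_zero, Complex.ofReal_one, one_mul]
      exact hL0
    · intro n
      have h1 := (lp.hasSum_single (ENNReal.ofReal_ne_top) (v (-n))).mapL L
      rw [hL _ (Submodule.subset_span ⟨-n, rfl⟩)] at h1
      rw [← h1.tsum_eq, ← (Equiv.addRight n).tsum_eq]
      refine tsum_congr (fun k => ?_)
      have : lp.single (E := fun _ : ℤ => ℂ) (ENNReal.ofReal p) k (v (-n) k) = v (-n) k • lp.single (E := fun _ : ℤ => ℂ) (ENNReal.ofReal p) k 1 := by
        rw [← lp.single_smul]; simp
      rw [this, map_smul, smul_eq_mul, hvn]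
      simp only [Equiv.coe_addRight]
      have e1 : n - (k + n) = -k := by ring
      rw [e1, om_neg, neg_neg, sub_neg_eq_add, ht]
      ring
    · have := (Equiv.neg ℤ).summable_iff.2 hsum
      refine this.congr (fun n => ?_)
      simp only [Function.comp, Equiv.neg_apply]
      congr 1
      rw [norm_mul, Complex.norm_real, Real.norm_eq_abs, abs_of_pos (om_pos _ _)]
      have h1 : om β n * om (-β) n = 1 := by rw [om_mul_om]; simp [om]
      calc _ = ‖t (-n)‖ * (om β n * om (-β) n) := by rw [h1, mul_one]
        _ = _ := by ring


lemma om_rpow (a b : ℝ) (n : ℤ) : (om a n) ^ b = om (a * b) n := by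
  unfold om
  rw [← Real.rpow_mul (by positivity)]

lemma om_le_one {a : ℝ} (ha : a ≤ 0) (n : ℤ) : om a n ≤ 1 := by
  unfold om
  exact Real.rpow_le_one_of_one_le_of_nonpos (by linarith [abs_nonneg (n : ℝ)]) ha

lemma summable_T {q β γ : ℝ} {m : ℕ} (hq : 2 < q) {S : ℤ → ℂ}
    (hS : Summable (fun n => (‖S n‖ * om (-β) n) ^ q))
    (hm : (q ≤ 2 * m ∧ m * β ≤ γ) ∨ (1 ≤ m ∧ 2 * m < q ∧ m * β + 1 / 2 - m / q < γ)) :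
    Summable (fun n => ‖S n‖ ^ (2 * m) * om (-(2 * γ)) n) := by
  set b := fun n => ‖S n‖ * om (-β) n with hb
  have hb0 : ∀ n, 0 ≤ b n := fun n => mul_nonneg (norm_nonneg _) (om_pos _ _).le
  have e : ∀ n, ‖S n‖ ^ (2 * m) * om (-(2 * γ)) n = b n ^ (2 * (m : ℝ)) * om (2 * m * β - 2 * γ) n := by
    intro n
    rw [hb]
    simp only
    rw [Real.mul_rpow (norm_nonneg _) (om_pos _ _).le, om_rpow, mul_assoc, om_mul_om]
    congr 1
    · rw [show (2 * (m : ℝ)) = ((2 * m : ℕ) : ℝ) by push_cast; ring, Real.rpow_natCast]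
    · congr 1
      ring
  simp_rw [e]
  rcases hm with ⟨hm1, hm2⟩ | ⟨hm0, hm1, hm2⟩
  · refine Summable.of_norm_bounded_eventually hS ?_
    have h1 := hS.tendsto_cofinite_zero.eventually (gt_mem_nhds (one_pos))
    filter_upwards [h1] with n hn
    have hbn : b n ≤ 1 := by
      by_contra hh
      push Not at hh
      have := Real.one_lt_rpow hh (show 0 < q by linarith)
      have h2 : b n ^ q < 1 := hn
      linarith
    have ho := om_pos (2 * m * β - 2 * γ) n
    have h3 : 0 ≤ b n ^ (2 * (m : ℝ)) := Real.rpow_nonneg (hb0 n) _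
    rw [Real.norm_eq_abs, abs_of_nonneg (by positivity)]
    calc _ ≤ b n ^ (2 * (m : ℝ)) * 1 := by
          gcongr
          exact om_le_one (by linarith) n
      _ ≤ _ := by
          rw [mul_one]
          exact Real.rpow_le_rpow_of_exponent_ge' (hb0 n) hbn (by linarith) hm1
  · have hm0' : (1 : ℝ) ≤ m := by exact_mod_cast hm0
    have hconj : (q / (2 * m)).HolderConjugate (q / (q - 2 * m)) := by
      rw [Real.holderConjugate_iff]
      constructor
      · rw [lt_div_iff₀ (by linarith)]; linarith
      · field_simp; ring
    have hneg : (2 * m * β - 2 * γ) * (q / (q - 2 * m)) < -1 := by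
      have h4 : m * β + 1 / 2 - m / q = m * β + (q - 2 * m) / (2 * q) := by
        field_simp
        ring
      rw [h4] at hm2
      have h5 : (q - 2 * m) / (2 * q) < γ - m * β := by linarith
      rw [div_lt_iff₀ (by linarith)] at h5
      rw [mul_div_assoc', div_lt_iff₀ (by linarith)]
      linarith
    have hsum := (hS.mul_left (1 / (q / (2 * m)))).add
      ((summable_om hneg).mul_left (1 / (q / (q - 2 * m))))
    refine Summable.of_nonneg_of_le (fun n => ?_) (fun n => ?_) hsum
    · exact mul_nonneg (Real.rpow_nonneg (hb0 n) _) (om_pos _ _).le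
    · have := Real.young_inequality_of_nonneg (Real.rpow_nonneg (hb0 n) (2 * (m : ℝ)))
        (om_pos (2 * m * β - 2 * γ) n).le hconj
      rw [om_rpow, ← Real.rpow_mul (hb0 n), mul_div_cancel₀ _ (by linarith)] at this
      refine this.trans_eq ?_
      show b n ^ q / _ + _ = 1 / _ * b n ^ q + _
      ring

lemma cyc {p q β γ : ℝ} {m : ℕ} (hp1 : 1 < p) (hp2 : p < 2) (hq : q = p / (p - 1)) (hβ : 0 ≤ β) (hβ1 : β < 1)
    (hγ : 0 ≤ γ) (hγ1 : γ ≤ 1)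
    (hm : (q ≤ 2 * m ∧ m * β ≤ γ) ∨ (1 ≤ m ∧ 2 * m < q ∧ m * β + 1 / 2 - m / q < γ))
    {E : Set (AddCircle (2 * π))} (hE : Cov m γ E) :
    ∀ c : ℤ → ℂ, MemA 1 β c → zeroSet c = E → IsCyclicA p β c := by
  intro c hc hz
  have hq2 : 2 < q := by
    rw [hq, lt_div_iff₀ (by linarith)]; linarith
  by_contra hn
  obtain ⟨S, hS0, hSc, hSs⟩ := dual hp1 hp2 hq hβ hc hn
  apply hS0
  have hb0 : ∀ n, 0 ≤ ‖S n‖ * om (-β) n := fun n => mul_nonneg (norm_nonneg _) (om_pos _ _).le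
  set X := ∑' n, (‖S n‖ * om (-β) n) ^ q with hX
  have hSb : ∀ n, ‖S n‖ ≤ X ^ (1 / q) * om β n := by
    intro n
    have h1 : (‖S n‖ * om (-β) n) ^ q ≤ X := hSs.le_tsum n (fun k _ => Real.rpow_nonneg (hb0 k) _)
    have h2 := Real.rpow_le_rpow (Real.rpow_nonneg (hb0 n) _) h1 (show 0 ≤ 1 / q by positivity)
    rw [← Real.rpow_mul (hb0 n), mul_one_div_cancel (by linarith), Real.rpow_one] at h2
    have h3 : om (-β) n * om β n = 1 := by rw [om_mul_om]; simp [om]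
    calc ‖S n‖ = (‖S n‖ * om (-β) n) * om β n := by rw [mul_assoc, h3, mul_one]
      _ ≤ _ := mul_le_mul_of_nonneg_right h2 (om_pos _ _).le
  refine cov_zero (m := m) (γ := γ) hβ hβ1 hγ hγ1 hSb (summable_of_memA hc) hSc (summable_T hq2 hSs hm) ?_
  rw [hz]
  exact hE

lemma cov_empty {m : ℕ} (hm : 1 ≤ m) (γ : ℝ) : Cov m γ ∅ := by
  intro ε hε
  refine ⟨1, one_pos, le_rfl, ∅, by simpa using hε.le, fun x hx => ?_⟩
  exact absurd (hx ⟨0, hm⟩) (by simp)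


/-- gap exponent -/
def hhs (α : ℝ) (j a : ℕ) : ℕ := ⌈(a : ℝ) / α⌉₊ + j + 2

/-- lattice exponents -/
def aa (α : ℝ) : ℕ → ℕ
  | 0 => 0
  | j + 1 => (j + 1) * (hhs α j (aa α j) + j + 2)

/-- gap exponents -/
def hh (α : ℝ) (j : ℕ) : ℕ := hhs α j (aa α j)

/-- block lengths -/
def bl (α : ℝ) (j : ℕ) : ℕ := aa α (j + 1) - hh α j

/-- cumulative block lengths -/
def cl (α : ℝ) : ℕ → ℕ
  | 0 => 0
  | j + 1 => cl α j + bl α j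

lemma aa_succ (α : ℝ) (j : ℕ) : aa α (j + 1) = (j + 1) * (hh α j + j + 2) := rfl

lemma hh_le_aa (α : ℝ) (j : ℕ) : hh α j + j + 2 ≤ aa α (j + 1) := by
  rw [aa_succ]
  nlinarith [Nat.zero_le (j * (hh α j + j + 2))]

lemma bl_add (α : ℝ) (j : ℕ) : bl α j + hh α j = aa α (j + 1) := by
  have := hh_le_aa α j
  unfold bl; omega

lemma hh_ge {α : ℝ} (hα : 0 < α) (j : ℕ) : (aa α j : ℝ) / α + j + 2 ≤ hh α j := by
  have := Nat.le_ceil ((aa α j : ℝ) / α)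
  unfold hh hhs
  push_cast
  linarith

lemma hh_le {α : ℝ} (hα : 0 < α) (j : ℕ) : (hh α j : ℝ) ≤ (aa α j : ℝ) / α + j + 3 := by
  have := Nat.ceil_lt_add_one (show 0 ≤ (aa α j : ℝ) / α by positivity)
  unfold hh hhs
  push_cast
  linarith

lemma aa_add_le_hh {α : ℝ} (hα : 0 < α) (hα1 : α < 1) (j : ℕ) : aa α j + j + 2 ≤ hh α j := by
  have h1 := hh_ge hα j
  have h2 : (aa α j : ℝ) ≤ (aa α j : ℝ) / α := by
    rw [le_div_iff₀ hα]
    have : (0 : ℝ) ≤ aa α j := by positivity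
    nlinarith
  have : ((aa α j + j + 2 : ℕ) : ℝ) ≤ hh α j := by push_cast; linarith
  exact_mod_cast this

lemma hh_add_le {α : ℝ} (hα : 0 < α) (hα1 : α < 1) (j i : ℕ) : hh α j + i ≤ hh α (j + i) := by
  induction i with
  | zero => simp
  | succ i ih =>
    have h1 := aa_add_le_hh hα hα1 (j + i + 1)
    have h2 := hh_le_aa α (j + i)
    show hh α j + (i + 1) ≤ hh α (j + i + 1)
    omega

/-- The integer prefix. -/
def Af (α : ℝ) (j : ℕ) (y : ℝ) : ℕ := ⌊2 ^ (cl α j) * y⌋₊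

/-- The digit. -/
def dg (α : ℝ) (j : ℕ) (y : ℝ) : ℕ := Af α (j + 1) y % 2 ^ (bl α j)

lemma Af_eq (α : ℝ) (j : ℕ) (y : ℝ) : Af α (j + 1) y = 2 ^ (bl α j) * Af α j y + dg α j y := by
  have h : Af α j y = Af α (j + 1) y / 2 ^ (bl α j) := by
    unfold Af
    rw [← Nat.floor_div_natCast]
    congr 1
    simp only [cl]
    push_cast
    rw [pow_add]
    field_simp
  rw [h]
  exact (Nat.div_add_mod _ _).symm

lemma dg_lt (α : ℝ) (j : ℕ) (y : ℝ) : dg α j y < 2 ^ (bl α j) := Nat.mod_lt _ (by positivity)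

/-- terms of the series -/
def tm (α : ℝ) (y : ℝ) (j : ℕ) : ℝ := dg α j y * (1 / 2) ^ (aa α (j + 1))

lemma half_pow_mul (n : ℕ) : (2 : ℝ) ^ n * (1 / 2) ^ n = 1 := by
  rw [← mul_pow]; norm_num

lemma tm_nonneg (α y : ℝ) (j : ℕ) : 0 ≤ tm α y j := by unfold tm; positivity

lemma tm_le (α y : ℝ) (j : ℕ) : tm α y j ≤ (1 / 2) ^ (hh α j) := by
  unfold tm
  rw [← bl_add, pow_add, ← mul_assoc]
  have h : (dg α j y : ℝ) ≤ 2 ^ (bl α j) := by exact_mod_cast (dg_lt α j y).le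
  calc _ ≤ ((2 : ℝ) ^ (bl α j) * (1 / 2) ^ (bl α j)) * (1 / 2) ^ (hh α j) := by gcongr
    _ = _ := by rw [half_pow_mul, one_mul]

lemma tm_shift_le {α : ℝ} (hα : 0 < α) (hα1 : α < 1) (y : ℝ) (j i : ℕ) :
    tm α y (i + j) ≤ (1 / 2) ^ (hh α j) * (1 / 2) ^ i := by
  refine (tm_le _ _ _).trans ?_
  rw [← pow_add]
  apply pow_le_pow_of_le_one (by norm_num) (by norm_num)
  rw [add_comm i j]
  exact hh_add_le hα hα1 j i

lemma tm_summable {α : ℝ} (hα : 0 < α) (hα1 : α < 1) (y : ℝ) : Summable (tm α y) :=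
  Summable.of_nonneg_of_le (tm_nonneg α y) (fun i => tm_shift_le hα hα1 y 0 i)
    (summable_geometric_two.mul_left _)

/-- The parametrisation of the Cantor set. -/
def Fm (α y : ℝ) : ℝ := ∑' j, tm α y j

lemma Fm_split {α : ℝ} (hα : 0 < α) (hα1 : α < 1) (y : ℝ) (j : ℕ) :
    ∑ i ∈ Finset.range j, tm α y i ≤ Fm α y ∧
    Fm α y ≤ ∑ i ∈ Finset.range j, tm α y i + 2 * (1 / 2) ^ (hh α j) := by
  have h := (tm_summable hα hα1 y).sum_add_tsum_nat_add j
  have hs : Summable (fun i => tm α y (i + j)) := (summable_nat_add_iff j).2 (tm_summable hα hα1 y)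
  have h1 : 0 ≤ ∑' i, tm α y (i + j) := tsum_nonneg (fun i => tm_nonneg _ _ _)
  have h2 : ∑' i, tm α y (i + j) ≤ ∑' i : ℕ, (1 / 2 : ℝ) ^ (hh α j) * (1 / 2) ^ i :=
    hs.tsum_le_tsum (fun i => tm_shift_le hα hα1 y j i) (summable_geometric_two.mul_left _)
  rw [tsum_mul_left, tsum_geometric_two] at h2
  unfold Fm
  constructor <;> linarith

lemma Fm_le {α : ℝ} (hα : 0 < α) (hα1 : α < 1) (y : ℝ) : 0 ≤ Fm α y ∧ Fm α y ≤ 1 / 2 := by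
  have h := Fm_split hα hα1 y 0
  simp only [Finset.range_zero, Finset.sum_empty, zero_add] at h
  have h2 : 2 ≤ hh α 0 := by have := aa_add_le_hh hα hα1 0; omega
  have h3 : (1 / 2 : ℝ) ^ (hh α 0) ≤ (1 / 2) ^ 2 := pow_le_pow_of_le_one (by norm_num) (by norm_num) h2
  constructor
  · exact h.1
  · norm_num at h3 h ⊢; linarith

/-- The Cantor type set on the line. -/
def KK (α : ℝ) : Set ℝ :=
  ⋂ j : ℕ, ⋃ p ∈ Finset.range (2 ^ (aa α j) + 1), Metric.closedBall ((p : ℝ) * (1 / 2) ^ (aa α j)) (2 * (1 / 2) ^ (hh α j))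

lemma mem_KK {α x : ℝ} : x ∈ KK α ↔ ∀ j, ∃ p : ℕ, p ≤ 2 ^ (aa α j) ∧
    dist x ((p : ℝ) * (1 / 2) ^ (aa α j)) ≤ (2 * (1 / 2) ^ (hh α j)) := by
  unfold KK
  simp

lemma aa_mono {α : ℝ} (hα : 0 < α) (hα1 : α < 1) {i j : ℕ} (h : i ≤ j) : aa α i ≤ aa α j := by
  induction j, h using Nat.le_induction with
  | base => exact le_rfl
  | succ j hj ih =>
    have := hh_le_aa α j
    have := aa_add_le_hh hα hα1 j
    omega

lemma Fm_mem {α : ℝ} (hα : 0 < α) (hα1 : α < 1) (y : ℝ) : Fm α y ∈ KK α := by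
  rw [mem_KK]
  intro j
  have h := Fm_split hα hα1 y j
  have h2 := Fm_le hα hα1 y
  set p := ∑ i ∈ Finset.range j, dg α i y * 2 ^ (aa α j - aa α (i + 1)) with hp
  have e : (p : ℝ) * (1 / 2) ^ (aa α j) = ∑ i ∈ Finset.range j, tm α y i := by
    rw [hp]
    push_cast
    rw [Finset.sum_mul]
    refine Finset.sum_congr rfl (fun i hi => ?_)
    have hle := aa_mono hα hα1 (show i + 1 ≤ j from Finset.mem_range.1 hi)
    unfold tm
    have : (1 / 2 : ℝ) ^ (aa α j) = (1 / 2) ^ (aa α j - aa α (i + 1)) * (1 / 2) ^ (aa α (i + 1)) := by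
      rw [← pow_add]; congr 1; omega
    rw [this, mul_assoc, ← mul_assoc ((2 : ℝ) ^ _), half_pow_mul, one_mul]
  refine ⟨p, ?_, ?_⟩
  · have : (p : ℝ) * (1 / 2) ^ (aa α j) ≤ 1 := by rw [e]; linarith
    have h3 : (p : ℝ) ≤ 2 ^ (aa α j) := by
      calc (p : ℝ) = ((p : ℝ) * (1 / 2) ^ (aa α j)) * 2 ^ (aa α j) := by
            rw [mul_assoc, mul_comm ((1 / 2 : ℝ) ^ _), half_pow_mul, mul_one]
        _ ≤ 1 * 2 ^ (aa α j) := by gcongr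
        _ = _ := one_mul _
    exact_mod_cast h3
  · rw [e, Real.dist_eq, abs_le]
    constructor <;> linarith [show (0 : ℝ) < (1 / 2) ^ (hh α j) by positivity]

lemma KK_compact (α : ℝ) : IsCompact (KK α) := by
  have hc : IsClosed (KK α) := isClosed_iInter (fun j => isClosed_biUnion_finset (fun p _ => Metric.isClosed_closedBall))
  refine IsCompact.of_isClosed_subset ?_ hc (Set.iInter_subset _ 0)
  exact (Finset.range _).finite_toSet.isCompact_biUnion (fun p _ => isCompact_closedBall _ _)

lemma cl_tendsto {α : ℝ} (n : ℕ) : n ≤ cl α n := by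
  induction n with
  | zero => simp
  | succ n ih =>
    have h1 := bl_add α n
    have h2 := hh_le_aa α n
    simp only [cl]
    omega

/-- separation of points -/
lemma Fm_sep {α : ℝ} (hα : 0 < α) (hα1 : α < 1) {y z : ℝ} (hy : 0 ≤ y) (hyz : y < z) (hz : z < 1) :
    ∃ j d : ℕ, 1 ≤ d ∧ d ≤ 2 ^ (bl α j) ∧ z - y ≤ 2 * d * (1 / 2) ^ (cl α (j + 1)) ∧
      (d : ℝ) * (1 / 2) ^ (aa α (j + 1) + 1) ≤ Fm α z - Fm α y := by
  have hex : ∃ n, Af α n y ≠ Af α n z := by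
    obtain ⟨n, hn⟩ := pow_unbounded_of_one_lt (1 / (z - y)) (one_lt_two)
    refine ⟨n, ?_⟩
    have h1 : (2 : ℝ) ^ n ≤ 2 ^ (cl α n) := pow_le_pow_right₀ (by norm_num) (cl_tendsto n)
    have h2 : 1 < 2 ^ (cl α n) * (z - y) := by
      rw [div_lt_iff₀ (by linarith)] at hn
      nlinarith
    unfold Af
    intro h
    have h3 := Nat.floor_le (show 0 ≤ 2 ^ (cl α n) * y by positivity)
    have h4 := Nat.lt_floor_add_one (2 ^ (cl α n) * z)
    rw [← h] at h4
    linarith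
  classical
  set n := Nat.find hex with hn
  have hn0 : Af α n y ≠ Af α n z := Nat.find_spec hex
  have hlt : ∀ i < n, Af α i y = Af α i z := fun i hi => not_not.1 (Nat.find_min hex hi)
  have hA0 : ∀ x : ℝ, 0 ≤ x → x < 1 → Af α 0 x = 0 := by
    intro x hx hx1
    unfold Af
    simp [cl, hx1]
  obtain ⟨j, hj⟩ : ∃ j, n = j + 1 := by
    apply Nat.exists_eq_succ_of_ne_zero
    intro h
    rw [h, hA0 y hy (by linarith), hA0 z (by linarith) hz] at hn0
    exact hn0 rfl
  rw [hj] at hn0 hlt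
  have hle : Af α (j + 1) y ≤ Af α (j + 1) z := by
    unfold Af
    apply Nat.floor_le_floor
    gcongr
  have e1 := Af_eq α j y
  have e2 := Af_eq α j z
  rw [hlt j (by omega)] at e1
  have hdz := dg_lt α j z
  refine ⟨j, dg α j z - dg α j y, by omega, by omega, ?_, ?_⟩
  · have h3 := Nat.floor_le (show 0 ≤ 2 ^ (cl α (j + 1)) * y by positivity)
    have h4 := Nat.lt_floor_add_one (2 ^ (cl α (j + 1)) * z)
    have h5 : Af α (j + 1) z + 1 ≤ Af α (j + 1) y + 2 * (dg α j z - dg α j y) := by omega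
    have h6 : ((Af α (j + 1) z : ℝ)) + 1 ≤ Af α (j + 1) y + 2 * ((dg α j z - dg α j y : ℕ) : ℝ) := by
      exact_mod_cast h5
    unfold Af at h6
    have h7 : 2 ^ (cl α (j + 1)) * (z - y) ≤ 2 * ((dg α j z - dg α j y : ℕ) : ℝ) := by linarith
    calc z - y = (2 ^ (cl α (j + 1)) * (z - y)) * (1 / 2) ^ (cl α (j + 1)) := by
          rw [mul_right_comm, half_pow_mul, one_mul]
      _ ≤ _ := by gcongr
  · have h1 := (Fm_split hα hα1 z (j + 1)).1
    have h2 := (Fm_split hα hα1 y (j + 1)).2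
    rw [Finset.sum_range_succ] at h1 h2
    have h3 : ∑ i ∈ Finset.range j, tm α z i = ∑ i ∈ Finset.range j, tm α y i := by
      refine Finset.sum_congr rfl (fun i hi => ?_)
      have hi := Finset.mem_range.1 hi
      unfold tm
      have e3 := Af_eq α i y
      have e4 := Af_eq α i z
      rw [hlt i (by omega), hlt (i + 1) (by omega)] at e3
      rw [show dg α i z = dg α i y by omega]
    have h4 : (1 / 2 : ℝ) ^ (hh α (j + 1)) ≤ (1 / 2) ^ (aa α (j + 1) + 2) := by
      apply pow_le_pow_of_le_one (by norm_num) (by norm_num)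
      have := aa_add_le_hh hα hα1 (j + 1)
      omega
    have h5 : ((dg α j z - dg α j y : ℕ) : ℝ) = dg α j z - dg α j y := by
      rw [Nat.cast_sub (by omega)]
    have h6 : (1 : ℝ) ≤ (dg α j z : ℝ) - dg α j y := by
      rw [← h5]; exact_mod_cast (show 1 ≤ dg α j z - dg α j y by omega)
    rw [h5]
    have h7 : (0 : ℝ) < (1 / 2) ^ (aa α (j + 1)) := by positivity
    rw [pow_succ] at h4 ⊢
    rw [pow_succ] at h4
    unfold tm at h1 h2 h3
    nlinarith


lemma growth {α r : ℝ} (hα : 0 < α) (hα1 : α < 1) (hr : 0 < r) (hrα : r < α) :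
    ∃ K : ℕ, ∀ j, (hh α j : ℝ) * r ≤ cl α j + K := by
  have hθ : 0 < 1 - r / α := by
    rw [sub_pos, div_lt_one hα]; exact hrα
  obtain ⟨j0, hj0⟩ := exists_nat_ge (1 / (1 - r / α))
  rw [div_le_iff₀ hθ] at hj0
  refine ⟨2 + ∑ i ∈ Finset.range (j0 + 1), hh α i, fun j => ?_⟩
  rcases lt_or_ge j (j0 + 1) with h | h
  · have h1 : hh α j ≤ ∑ i ∈ Finset.range (j0 + 1), hh α i :=
      Finset.single_le_sum (fun i _ => Nat.zero_le _) (Finset.mem_range.2 h)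
    have h2 : (hh α j : ℝ) ≤ ((∑ i ∈ Finset.range (j0 + 1), hh α i : ℕ) : ℝ) := by exact_mod_cast h1
    have h3 : (0 : ℝ) ≤ hh α j := by positivity
    have h4 : (0 : ℝ) ≤ cl α j := by positivity
    push_cast at h2 ⊢
    nlinarith
  · obtain ⟨i, rfl⟩ : ∃ i, j = i + 1 := ⟨j - 1, by omega⟩
    have h1 := hh_le hα (i + 1)
    have h2 : aa α (i + 1) ≤ cl α (i + 1) + hh α i := by
      have := bl_add α i
      simp only [cl]; omega
    have h2' : (aa α (i + 1) : ℝ) ≤ cl α (i + 1) + hh α i := by exact_mod_cast h2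
    have h3 : (aa α (i + 1) : ℝ) = (i + 1) * (hh α i + i + 2) := by
      rw [aa_succ]; push_cast; ring
    have h4 : (1 - r / α) * aa α (i + 1) ≥ hh α i + i + 2 := by
      rw [h3]
      have h5 : 1 ≤ (1 - r / α) * (i + 1) := by
        have : (j0 : ℝ) ≤ i + 1 := by exact_mod_cast (by omega : j0 ≤ i + 1)
        nlinarith
      have h6 : (0 : ℝ) ≤ hh α i + i + 2 := by positivity
      nlinarith
    have h7 : (hh α (i + 1) : ℝ) * r ≤ r / α * aa α (i + 1) + (i + 4) := by
      push_cast at h1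
      calc (hh α (i + 1) : ℝ) * r ≤ (aa α (i + 1) / α + (i + 1) + 3) * r := by gcongr
        _ = r / α * aa α (i + 1) + (i + 4) * r := by ring
        _ ≤ r / α * aa α (i + 1) + (i + 4) * 1 := by gcongr; linarith
        _ = _ := by ring
    have h8 : (0 : ℝ) ≤ ((∑ i ∈ Finset.range (j0 + 1), hh α i : ℕ) : ℝ) := by positivity
    push_cast at h8 ⊢
    linarith

lemma holder_inv {α r : ℝ} (hα : 0 < α) (hα1 : α < 1) (hr : 0 < r) (hrα : r < α) :
    ∃ C : ℝ, 0 < C ∧ ∀ y z : ℝ, 0 ≤ y → y < z → z < 1 → z - y ≤ C * |Fm α z - Fm α y| ^ r := by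
  obtain ⟨K, hK⟩ := growth hα hα1 hr hrα
  refine ⟨4 * 2 ^ K, by positivity, fun y z hy hyz hz => ?_⟩
  obtain ⟨j, d, hd1, hdb, h1, h2⟩ := Fm_sep hα hα1 hy hyz hz
  have hd0 : (0 : ℝ) ≤ d := by positivity
  have hpos : 0 ≤ (d : ℝ) * (1 / 2) ^ (aa α (j + 1) + 1) := by positivity
  rw [abs_of_nonneg (hpos.trans h2)]
  refine h1.trans ?_
  have h3 := Real.rpow_le_rpow hpos h2 hr.le
  refine le_trans ?_ (mul_le_mul_of_nonneg_left h3 (by positivity))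
  set u := (d : ℝ) * (1 / 2) ^ (bl α j) with hu
  have hu0 : 0 ≤ u := by positivity
  have hu1 : u ≤ 1 := by
    have : (d : ℝ) ≤ 2 ^ (bl α j) := by exact_mod_cast hdb
    rw [← half_pow_mul (bl α j), hu]
    gcongr
  have hur : u ≤ u ^ r := by
    conv_lhs => rw [← Real.rpow_one u]
    exact Real.rpow_le_rpow_of_exponent_ge' hu0 hu1 hr.le (by linarith)
  have e1 : (d : ℝ) * (1 / 2) ^ (aa α (j + 1) + 1) = u * (1 / 2) ^ (hh α j) * (1 / 2) := by
    rw [← bl_add, hu, pow_succ, pow_add]; ring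
  have e2 : 2 * (d : ℝ) * (1 / 2) ^ (cl α (j + 1)) = 2 * u * (1 / 2) ^ (cl α j) := by
    rw [hu]; simp only [cl]; rw [pow_add]; ring
  rw [e1, e2, Real.mul_rpow (by positivity) (by norm_num), Real.mul_rpow hu0 (by positivity)]
  have h4 : (1 / 2 : ℝ) ≤ (1 / 2) ^ r := by
    conv_lhs => rw [← Real.rpow_one (1 / 2)]
    exact Real.rpow_le_rpow_of_exponent_ge (by norm_num) (by norm_num) (by linarith)
  have h5 : (1 / 2 : ℝ) ^ (cl α j) * (1 / 2) ^ K ≤ ((1 / 2 : ℝ) ^ (hh α j)) ^ r := by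
    rw [← pow_add, ← Real.rpow_natCast, ← Real.rpow_natCast, ← Real.rpow_mul (by norm_num)]
    apply Real.rpow_le_rpow_of_exponent_ge (by norm_num) (by norm_num)
    push_cast
    exact hK j
  have h6 := half_pow_mul K
  calc 2 * u * (1 / 2) ^ (cl α j) = 4 * 2 ^ K * (u * ((1 / 2) ^ (cl α j) * (1 / 2) ^ K) * (1 / 2)) := by
        calc _ = 2 * u * (1 / 2) ^ (cl α j) * ((2 : ℝ) ^ K * (1 / 2) ^ K) := by rw [h6, mul_one]
          _ = _ := by ring
    _ ≤ 4 * 2 ^ K * (u ^ r * ((1 / 2 : ℝ) ^ (hh α j)) ^ r * (1 / 2) ^ r) := by gcongr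

lemma dimH_of_antiholder {X : Type*} [EMetricSpace X] {E : Set X} {φ : ℝ → X} {C r : NNReal} (hr : 0 < r)
    (hφ : ∀ y ∈ Ico (0 : ℝ) 1, φ y ∈ E)
    (h : ∀ y ∈ Ico (0 : ℝ) 1, ∀ z ∈ Ico (0 : ℝ) 1, edist y z ≤ C * edist (φ y) (φ z) ^ (r : ℝ)) :
    (r : ℝ≥0∞) ≤ dimH E := by
  have hinj : InjOn φ (Ico (0 : ℝ) 1) := by
    intro y hy z hz hyz
    have := h y hy z hz
    rw [hyz, edist_self, ENNReal.zero_rpow_of_pos (by exact_mod_cast hr), mul_zero] at this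
    exact edist_eq_zero.1 (le_antisymm this bot_le)
  set g := Function.invFunOn φ (Ico (0 : ℝ) 1) with hg
  have hgφ : ∀ y ∈ Ico (0 : ℝ) 1, g (φ y) = y := fun y hy => hinj.leftInvOn_invFunOn hy
  have hH : HolderOnWith C r g (φ '' Ico (0 : ℝ) 1) := by
    rintro _ ⟨y, hy, rfl⟩ _ ⟨z, hz, rfl⟩
    rw [hgφ y hy, hgφ z hz]
    exact h y hy z hz
  have h1 := hH.dimH_image_le hr
  have h2 : g '' (φ '' Ico (0 : ℝ) 1) = Ico (0 : ℝ) 1 := by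
    rw [← image_comp]
    ext x
    constructor
    · rintro ⟨y, hy, rfl⟩
      rw [Function.comp, hgφ y hy]; exact hy
    · intro hx
      exact ⟨x, hx, hgφ x hx⟩
  rw [h2, Real.dimH_of_nonempty_interior (by simp)] at h1
  have h3 : dimH (φ '' Ico (0 : ℝ) 1) ≤ dimH E := dimH_mono (by rintro _ ⟨y, hy, rfl⟩; exact hφ y hy)
  simp only [Module.finrank_self, Nat.cast_one] at h1
  rw [ENNReal.le_div_iff_mul_le (Or.inl (by exact_mod_cast hr.ne')) (Or.inl ENNReal.coe_ne_top), one_mul] at h1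
  exact h1.trans h3

/-- The Cantor type set on the circle. -/
def EE (α : ℝ) : Set (AddCircle (2 * π)) := (fun x : ℝ => (x : AddCircle (2 * π))) '' KK α

lemma EE_closed (α : ℝ) : IsClosed (EE α) :=
  ((KK_compact α).image (AddCircle.continuous_mk' (2 * π))).isClosed

lemma norm_coe_le (x : ℝ) : ‖(x : AddCircle (2 * π))‖ ≤ |x| := by
  exact QuotientAddGroup.norm_mk_le_norm (S := AddSubgroup.zmultiples (2 * π)) (m := x)

lemma dist_coe_eq {x y : ℝ} (h : |x - y| ≤ 1) : dist (x : AddCircle (2 * π)) (y : AddCircle (2 * π)) = |x - y| := by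
  rw [dist_eq_norm, ← AddCircle.coe_sub]
  have hpi := Real.pi_gt_three
  have h2 : |2 * π| = 2 * π := abs_of_pos (by positivity)
  refine (AddCircle.norm_coe_eq_abs_iff (2 * π) (by positivity)).2 ?_
  rw [h2]
  linarith

lemma dist_coe_le (x y : ℝ) : dist (x : AddCircle (2 * π)) (y : AddCircle (2 * π)) ≤ |x - y| := by
  rw [dist_eq_norm, ← AddCircle.coe_sub]
  exact norm_coe_le _

lemma le_dimH_EE {α : ℝ} (hα : 0 < α) (hα1 : α < 1) : ENNReal.ofReal α ≤ dimH (EE α) := by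
  refine le_of_forall_lt (fun b hb => ?_)
  have hbt : b ≠ ⊤ := hb.ne_top
  have hb' : b.toReal < α := by
    rw [← ENNReal.ofReal_toReal hbt] at hb
    exact (ENNReal.ofReal_lt_ofReal_iff hα).1 hb
  obtain ⟨r, hr1, hr2⟩ := exists_between hb'
  have hr0 : 0 < r := lt_of_le_of_lt ENNReal.toReal_nonneg hr1
  have hbr : b < ENNReal.ofReal r := by
    rw [← ENNReal.ofReal_toReal hbt]
    exact (ENNReal.ofReal_lt_ofReal_iff hr0).2 hr1
  refine hbr.trans_le ?_
  obtain ⟨C, hC, h⟩ := holder_inv hα hα1 hr0 hr2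
  have := dimH_of_antiholder (E := EE α) (φ := fun y => ((Fm α y : ℝ) : AddCircle (2 * π)))
    (C := C.toNNReal) (r := r.toNNReal) (by simpa using hr0) (fun y hy => ⟨_, Fm_mem hα hα1 y, rfl⟩) ?_
  · exact this
  · have key : ∀ y z : ℝ, 0 ≤ y → y < z → z < 1 →
        edist y z ≤ C.toNNReal * edist ((Fm α y : ℝ) : AddCircle (2 * π)) ((Fm α z : ℝ) : AddCircle (2 * π)) ^ ((r.toNNReal : NNReal) : ℝ) := by
      intro y z hy hyz hz
      have h1 := h y z hy hyz hz
      have hFy := Fm_le hα hα1 y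
      have hFz := Fm_le hα hα1 z
      rw [edist_comm, edist_dist, edist_dist, dist_comm ((Fm α y : ℝ) : AddCircle (2 * π)), dist_coe_eq (by rw [abs_le]; constructor <;> linarith),
        Real.coe_toNNReal r hr0.le, ENNReal.ofReal_rpow_of_nonneg (abs_nonneg _) hr0.le]
      show _ ≤ ENNReal.ofReal C * _
      rw [← ENNReal.ofReal_mul hC.le]
      apply ENNReal.ofReal_le_ofReal
      rw [Real.dist_eq, abs_of_pos (by linarith)]
      exact h1
    intro y hy z hz
    rcases lt_trichotomy y z with hlt | rfl | hlt
    · exact key y z hy.1 hlt hz.2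
    · simp
    · rw [edist_comm y z, edist_comm ((Fm α y : ℝ) : AddCircle (2 * π))]
      exact key z y hz.1 hlt hy.2

lemma count_bound {α : ℝ} (hα : 0 < α) (j : ℕ) :
    (2 : ℝ) ^ (aa α j) * ((1 / 2 : ℝ) ^ (hh α j)) ^ α ≤ ((1 / 2 : ℝ) ^ α) ^ j := by
  have h1 : ((1 / 2 : ℝ) ^ (hh α j)) ^ α ≤ (1 / 2) ^ (aa α j) * ((1 / 2 : ℝ) ^ α) ^ j := by
    rw [← Real.rpow_natCast, ← Real.rpow_natCast, ← Real.rpow_natCast, ← Real.rpow_mul (by norm_num),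
      ← Real.rpow_mul (by norm_num), ← Real.rpow_add (by norm_num)]
    apply Real.rpow_le_rpow_of_exponent_ge (by norm_num) (by norm_num)
    have := hh_ge hα j
    calc (aa α j : ℝ) + α * j ≤ (aa α j / α + j + 2) * α := by
          rw [add_mul, add_mul, div_mul_cancel₀ _ hα.ne']; linarith
      _ ≤ _ := by gcongr
  calc _ ≤ (2 : ℝ) ^ (aa α j) * ((1 / 2) ^ (aa α j) * ((1 / 2 : ℝ) ^ α) ^ j) := by gcongr
    _ = _ := by rw [← mul_assoc, half_pow_mul, one_mul]

lemma hh_ge_self {α : ℝ} (j : ℕ) : j ≤ hh α j := by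
  unfold hh hhs; omega

lemma dimH_EE_le {α : ℝ} (hα : 0 < α) (hα1 : α < 1) : dimH (EE α) ≤ ENNReal.ofReal α := by
  have hL : LipschitzWith 1 (fun x : ℝ => (x : AddCircle (2 * π))) := by
    refine LipschitzWith.of_dist_le_mul (fun x y => ?_)
    rw [NNReal.coe_one, one_mul, Real.dist_eq]
    exact dist_coe_le x y
  refine (hL.dimH_image_le (KK α)).trans ?_
  have hs0 : Tendsto (fun j : ℕ => (1 / 2 : ℝ) ^ j) atTop (𝓝 0) :=
    tendsto_pow_atTop_nhds_zero_of_lt_one (by norm_num) (by norm_num)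
  have hdiam : ∀ j, ∀ i : Fin (2 ^ (aa α j) + 1), Metric.ediam (Metric.closedBall (((i : ℕ) : ℝ) * (1 / 2) ^ (aa α j)) (2 * (1 / 2) ^ (hh α j))) ≤
      ENNReal.ofReal (4 * (1 / 2) ^ (hh α j)) := by
    intro j i
    rw [Real.closedBall_eq_Icc, Real.ediam_Icc]
    apply ENNReal.ofReal_le_ofReal
    linarith
  have h := Measure.hausdorffMeasure_le_liminf_sum (ι := fun j : ℕ => Fin (2 ^ (aa α j) + 1)) α (KK α) (l := atTop)
    (fun j : ℕ => ENNReal.ofReal (4 * (1 / 2) ^ (hh α j))) ?_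
    (fun j i => Metric.closedBall (((i : ℕ) : ℝ) * (1 / 2) ^ (aa α j)) (2 * (1 / 2) ^ (hh α j)))
    (Eventually.of_forall hdiam) (Eventually.of_forall ?_)
  · have h2 : ∀ j : ℕ, ∑ i : Fin (2 ^ (aa α j) + 1), Metric.ediam (Metric.closedBall (((i : ℕ) : ℝ) * (1 / 2) ^ (aa α j)) (2 * (1 / 2) ^ (hh α j))) ^ α
        ≤ ENNReal.ofReal 8 := by
      intro j
      refine (Finset.sum_le_sum (fun i _ => ENNReal.rpow_le_rpow (hdiam j i) hα.le)).trans ?_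
      rw [Finset.sum_const, Finset.card_univ, Fintype.card_fin, nsmul_eq_mul,
        ENNReal.ofReal_rpow_of_nonneg (by positivity) hα.le, ← ENNReal.ofReal_natCast,
        ← ENNReal.ofReal_mul (by positivity)]
      apply ENNReal.ofReal_le_ofReal
      rw [Real.mul_rpow (by norm_num) (by positivity)]
      have h3 := count_bound hα j
      have h4 : ((1 / 2 : ℝ) ^ α) ^ j ≤ 1 :=
        pow_le_one₀ (by positivity) (Real.rpow_le_one (by norm_num) (by norm_num) hα.le)
      have h5 : (4 : ℝ) ^ α ≤ 4 := by
        conv_rhs => rw [← Real.rpow_one 4]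
        exact Real.rpow_le_rpow_of_exponent_le (by norm_num) hα1.le
      have h6 : (1 : ℝ) ≤ 2 ^ (aa α j) := one_le_pow₀ (by norm_num)
      push_cast
      calc ((2 : ℝ) ^ (aa α j) + 1) * (4 ^ α * ((1 / 2 : ℝ) ^ (hh α j)) ^ α)
          ≤ (2 * 2 ^ (aa α j)) * (4 * ((1 / 2 : ℝ) ^ (hh α j)) ^ α) := by gcongr; linarith
        _ = 8 * (2 ^ (aa α j) * ((1 / 2 : ℝ) ^ (hh α j)) ^ α) := by ring
        _ ≤ 8 * 1 := by gcongr; linarith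
        _ = 8 := by norm_num
    have h3 : μH[α] (KK α) ≤ ENNReal.ofReal 8 := by
      refine h.trans ?_
      refine (liminf_le_liminf (Eventually.of_forall h2)).trans ?_
      simp
    have h4 := dimH_le_of_hausdorffMeasure_ne_top (d := α.toNNReal) (s := KK α) ?_
    · exact h4
    · rw [Real.coe_toNNReal α hα.le]
      exact ne_top_of_le_ne_top ENNReal.ofReal_ne_top h3
  · rw [← ENNReal.ofReal_zero]
    refine ENNReal.tendsto_ofReal ?_
    have h1 : Tendsto (fun j : ℕ => 4 * (1 / 2 : ℝ) ^ j) atTop (𝓝 0) := by simpa using hs0.const_mul 4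
    refine squeeze_zero (fun j => by positivity) (fun j => ?_) h1
    gcongr 4 * ?_
    exact pow_le_pow_of_le_one (by norm_num) (by norm_num) (hh_ge_self j)
  · intro j x hx
    obtain ⟨p, hp, hd⟩ := mem_KK.1 hx j
    exact Set.mem_iUnion.2 ⟨⟨p, by omega⟩, hd⟩

lemma cov_EE {γ : ℝ} (hγ : 0 < 1 - 2 * γ) {m : ℕ} (hm : 1 ≤ m) : Cov m γ (EE (1 - 2 * γ)) := by
  set α := 1 - 2 * γ with hαd
  intro ε hε
  have hm' : (1 : ℝ) ≤ m := by exact_mod_cast hm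
  have hs0 : Tendsto (fun j : ℕ => (2 * m) * (1 / 2 : ℝ) ^ j) atTop (𝓝 0) := by
    simpa using (tendsto_pow_atTop_nhds_zero_of_lt_one (by norm_num) (by norm_num : (1 / 2 : ℝ) < 1)).const_mul (2 * (m : ℝ))
  have hs1 : Tendsto (fun j : ℕ => (2 * m * (2 * m) ^ α) * ((1 / 2 : ℝ) ^ α) ^ j) atTop (𝓝 0) := by
    simpa using (tendsto_pow_atTop_nhds_zero_of_lt_one (by positivity)
      (Real.rpow_lt_one (by norm_num) (by norm_num : (1 / 2 : ℝ) < 1) hγ)).const_mul (2 * m * (2 * (m : ℝ)) ^ α)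
  obtain ⟨j, hj0, hj1⟩ := ((hs0.eventually (gt_mem_nhds one_pos)).and (hs1.eventually (gt_mem_nhds hε))).exists
  have hhj : (1 / 2 : ℝ) ^ (hh α j) ≤ (1 / 2) ^ j := pow_le_pow_of_le_one (by norm_num) (by norm_num) (hh_ge_self j)
  classical
  refine ⟨2 * m * (1 / 2) ^ (hh α j), by positivity, ?_,
    (Finset.range (m * 2 ^ (aa α j) + 1)).image (fun p : ℕ => (((p : ℝ) * (1 / 2) ^ (aa α j) : ℝ) : AddCircle (2 * π))), ?_, ?_⟩
  · calc _ ≤ 2 * m * (1 / 2 : ℝ) ^ j := by gcongr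
      _ ≤ 1 := hj0.le
  · have hcard := Finset.card_image_le (s := Finset.range (m * 2 ^ (aa α j) + 1))
      (f := fun p : ℕ => (((p : ℝ) * (1 / 2) ^ (aa α j) : ℝ) : AddCircle (2 * π)))
    rw [Finset.card_range] at hcard
    have h6 : 1 ≤ m * 2 ^ (aa α j) := Nat.one_le_iff_ne_zero.2 (by positivity)
    have hcard' : (((Finset.range (m * 2 ^ (aa α j) + 1)).image (fun p : ℕ => (((p : ℝ) * (1 / 2) ^ (aa α j) : ℝ) : AddCircle (2 * π)))).card : ℝ) ≤ 2 * m * 2 ^ (aa α j) := by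
      have := hcard.trans (show m * 2 ^ (aa α j) + 1 ≤ 2 * m * 2 ^ (aa α j) by linarith)
      exact_mod_cast this
    rw [Real.mul_rpow (by positivity) (by positivity)]
    have h3 := count_bound hγ j
    calc _ ≤ (2 * m * 2 ^ (aa α j)) * ((2 * (m : ℝ)) ^ α * ((1 / 2 : ℝ) ^ (hh α j)) ^ α) := by gcongr
      _ = (2 * m * (2 * m) ^ α) * (2 ^ (aa α j) * ((1 / 2 : ℝ) ^ (hh α j)) ^ α) := by ring
      _ ≤ (2 * m * (2 * m) ^ α) * ((1 / 2 : ℝ) ^ α) ^ j := by gcongr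
      _ ≤ ε := hj1.le
  · intro x hx
    choose y hy hyx using hx
    have : ∀ i, ∃ p : ℕ, p ≤ 2 ^ (aa α j) ∧ dist (y i) ((p : ℝ) * (1 / 2) ^ (aa α j)) ≤ (2 * (1 / 2) ^ (hh α j)) :=
      fun i => mem_KK.1 (hy i) j
    choose p hp hpd using this
    refine ⟨_, Finset.mem_image_of_mem _ (a := ∑ i, p i) ?_, ?_⟩
    · rw [Finset.mem_range, Nat.lt_succ_iff]
      refine (Finset.sum_le_sum (fun i _ => hp i)).trans ?_
      simp
    · have e1 : ∑ i, x i = ((∑ i, y i : ℝ) : AddCircle (2 * π)) := by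
        rw [← QuotientAddGroup.mk'_apply, map_sum]
        exact Finset.sum_congr rfl (fun i _ => (hyx i).symm)
      rw [e1]
      refine (dist_coe_le _ _).trans ?_
      rw [← Real.dist_eq]
      push_cast
      rw [Finset.sum_mul]
      refine (dist_sum_sum_le_of_le _ (fun i _ => hpd i)).trans_eq ?_
      simp
      ring

/-- Theorem 3.3(4): let `1 < p < 2`, `β > 0`, `βq ≤ 1` where
`q = p/(p-1)`, and `k = ⌊q/2⌋`. For every `ε > 0` there is a closed set
`E ⊆ 𝕋` with `dim E ≥ max((2/q)(1-βq)k - ε, 1 - 2(k+1)β)` such that every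
`f ∈ A^1_β(𝕋)` with `Z(f) = E` is cyclic in `A^p_β(𝕋)`. Moreover, if
`p = 2k'/(2k'-1)` for some positive integer `k'`, one can choose `E` with
`dim E = 1 - βq`. -/
theorem stmt3 (p q β : ℝ) (hp1 : 1 < p) (hp2 : p < 2) (hβ : 0 < β)
    (hq : q = p / (p - 1)) (hβq : β * q ≤ 1)
    (k : ℕ) (hk : k = ⌊q / 2⌋₊) :
    (∀ ε : ℝ, 0 < ε →
      ∃ E : Set (AddCircle (2 * Real.pi)), IsClosed E ∧
        ENNReal.ofReal (max ((2 / q) * (1 - β * q) * (k : ℝ) - ε)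
          (1 - 2 * ((k : ℝ) + 1) * β)) ≤ dimH E ∧
        ∀ c : ℤ → ℂ, MemA 1 β c → zeroSet c = E → IsCyclicA p β c) ∧
    ((∃ k' : ℕ, 0 < k' ∧ p = 2 * (k' : ℝ) / (2 * (k' : ℝ) - 1)) →
      ∃ E : Set (AddCircle (2 * Real.pi)), IsClosed E ∧
        dimH E = ENNReal.ofReal (1 - β * q) ∧
        ∀ c : ℤ → ℂ, MemA 1 β c → zeroSet c = E → IsCyclicA p β c) := by
  have hq2 : 2 < q := by
    rw [hq, lt_div_iff₀ (by linarith)]; linarith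
  have hq0 : 0 < q := by linarith
  have hβ1 : β < 1 / 2 := by
    by_contra h
    push Not at h
    nlinarith
  have hk1 : (k : ℝ) ≤ q / 2 := by rw [hk]; exact Nat.floor_le (by positivity)
  have hk2 : q / 2 < k + 1 := by rw [hk]; exact Nat.lt_floor_add_one _
  have hk0 : 1 ≤ k := by rw [hk]; exact Nat.le_floor (by push_cast; linarith)
  have hk0' : (1 : ℝ) ≤ k := by exact_mod_cast hk0
  constructor
  · intro ε hε
    set A := (2 / q) * (1 - β * q) * (k : ℝ) - ε with hA
    set B := 1 - 2 * ((k : ℝ) + 1) * β with hB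
    have hAe : A = 2 * k / q - 2 * k * β - ε := by
      rw [hA]; field_simp
    have hkq : 2 * (k : ℝ) / q ≤ 1 := by rw [div_le_one hq0]; linarith
    have hγ1 : ((k : ℝ) + 1) * β ≤ 1 := by nlinarith
    have hg1 : (q ≤ 2 * ((k + 1 : ℕ) : ℝ) ∧ ((k + 1 : ℕ) : ℝ) * β ≤ ((k : ℝ) + 1) * β) := by
      push_cast
      constructor <;> linarith
    rcases le_or_gt (max A B) 0 with h0 | h0
    · refine ⟨∅, isClosed_empty, ?_, ?_⟩
      · rw [ENNReal.ofReal_of_nonpos h0]; exact bot_le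
      · exact cyc hp1 hp2 hq hβ.le (by linarith) (by positivity) hγ1 (Or.inl hg1)
          (cov_empty (by omega) (((k : ℝ) + 1) * β))
    · rcases le_or_gt A B with hAB | hAB
      · rw [max_eq_right hAB] at h0 ⊢
        have e : B = 1 - 2 * (((k : ℝ) + 1) * β) := by rw [hB]; ring
        refine ⟨EE B, EE_closed _, ?_, ?_⟩
        · exact le_dimH_EE h0 (by rw [hB]; nlinarith)
        · refine cyc hp1 hp2 hq hβ.le (by linarith) (by positivity) hγ1 (Or.inl hg1) ?_
          rw [e] at h0 ⊢
          exact cov_EE h0 (by omega)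
      · rw [max_eq_left hAB.le] at h0 ⊢
        have e : A = 1 - 2 * ((1 - A) / 2) := by ring
        have hA1 : A < 1 := by
          rw [hAe]
          have : 0 < 2 * k * β := by positivity
          linarith
        refine ⟨EE A, EE_closed _, ?_, ?_⟩
        · exact le_dimH_EE h0 hA1
        · refine cyc (m := k) (γ := (1 - A) / 2) hp1 hp2 hq hβ.le (by linarith) (by linarith) (by linarith) ?_ ?_
          · have h5 : 2 * (k : ℝ) / q = 2 * (k / q) := by ring
            rcases lt_or_ge (2 * (k : ℝ)) q with h | h
            · refine Or.inr ⟨hk0, h, ?_⟩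
              linarith
            · refine Or.inl ⟨h, ?_⟩
              linarith
          · have h1 := cov_EE (γ := (1 - A) / 2) (m := k) (by rw [← e]; exact h0) hk0
            rw [← e] at h1
            exact h1
  · rintro ⟨k', hk', hpk⟩
    have hk1' : (1 : ℝ) ≤ k' := by exact_mod_cast hk'
    have hqk : q = 2 * k' := by
      have h1 : (2 * (k' : ℝ) - 1) ≠ 0 := by linarith
      have h2 : p - 1 = 1 / (2 * (k' : ℝ) - 1) := by rw [hpk]; field_simp; ring
      rw [hq, h2, hpk]
      field_simp
    have hm : (q ≤ 2 * (k' : ℝ) ∧ (k' : ℝ) * β ≤ (k' : ℝ) * β) := ⟨hqk.le, le_rfl⟩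
    have hγ1 : (k' : ℝ) * β ≤ 1 := by rw [hqk] at hβq; linarith
    have e : 1 - β * q = 1 - 2 * ((k' : ℝ) * β) := by rw [hqk]; ring
    rcases (sub_nonneg.2 hβq).eq_or_lt with h0 | h0
    · refine ⟨∅, isClosed_empty, ?_, ?_⟩
      · rw [← h0]; simp
      · exact cyc hp1 hp2 hq hβ.le (by linarith) (by positivity) hγ1 (Or.inl hm)
          (cov_empty hk' _)
    · have h1 : 1 - β * q < 1 := by nlinarith
      refine ⟨EE (1 - β * q), EE_closed _, ?_, ?_⟩
      · exact le_antisymm (dimH_EE_le h0 h1) (le_dimH_EE h0 h1)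
      · refine cyc hp1 hp2 hq hβ.le (by linarith) (by positivity) hγ1 (Or.inl hm) ?_
        rw [e] at h0 ⊢
        exact cov_EE h0 hk'

end
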